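/- Let G = F ∗ A₁ ∗ ⋯ ∗ A_k be the free product of a free group F of finite rank and finitely many free abelian groups A₁,…,A_k of finite ranks, with finite generating set B consisting of a basis of F together with bases of the A_i. There exists a constant N (depending only on G) such that for all integers g ≥ 0, m ≥ 1 and all elements C₁,…,C_{m−1}, C ∈ G: if there exist x₁,…,x_g, y₁,…,y_g, z₁,…,z_{m−1} ∈ G with (∏_{i=1}^{g} [x_i, y_i])·(∏_{j=1}^{m−1} z_j⁻¹ C_j z_j)·C = 1, then there exist such elements which additionally satisfy |x_i| ≤ N·s², |y_i| ≤ N·s² and |z_j| ≤ N·s² for all i, j, where s = 2g + (m−1) + ∑_{j=1}^{m−1}|C_j| + |C|. -/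

import Mathlib

/- G = F ∗ A₁ ∗ ⋯ ∗ A_k : free product of a free group of finite rank r and
free abelian groups of finite ranks, with generating set B a basis of F together
with bases of the Aᵢ. -/

namespace Stmt2

/-- The family of factors: index `none` is the free group, `some i` the i-th free
abelian group (written multiplicatively). -/
def Fam (r k : ℕ) (ranks : Fin k → ℕ) : Option (Fin k) → Type
  | none => FreeGroup (Fin r)
  | some i => Multiplicative (Fin (ranks i) →₀ ℤ)

noncomputable instance (r k : ℕ) (ranks : Fin k → ℕ) : (i : Option (Fin k)) → Group (Fam r k ranks i)
  | none => inferInstanceAs (Group (FreeGroup (Fin r)))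
  | some i => inferInstanceAs (Group (Multiplicative (Fin (ranks i) →₀ ℤ)))

/-- The free product G = F ∗ A₁ ∗ ⋯ ∗ A_k. -/
abbrev G (r k : ℕ) (ranks : Fin k → ℕ) : Type := Monoid.CoprodI (Fam r k ranks)

/-- The generating set: a basis of F together with a basis of each Aᵢ. -/
abbrev B (r k : ℕ) (ranks : Fin k → ℕ) : Type := Fin r ⊕ (Σ i : Fin k, Fin (ranks i))

/-- The generators of G indexed by B. -/
noncomputable def gen (r k : ℕ) (ranks : Fin k → ℕ) : B r k ranks → G r k ranks
  | Sum.inl j => Monoid.CoprodI.of (M := Fam r k ranks) (i := none)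
      (show Fam r k ranks none from FreeGroup.of j)
  | Sum.inr ⟨i, j⟩ => Monoid.CoprodI.of (M := Fam r k ranks) (i := some i)
      (show Fam r k ranks (some i) from Multiplicative.ofAdd (Finsupp.single j (1 : ℤ)))

/-- Word length of an element of G with respect to the generating set B:
the least n such that the element is a product of n elements of B ∪ B⁻¹. -/
noncomputable def wl (r k : ℕ) (ranks : Fin k → ℕ) (x : G r k ranks) : ℕ :=
  sInf {n | ∃ l : List (G r k ranks), l.length = n ∧
    (∀ y ∈ l, ∃ b, y = gen r k ranks b ∨ y = (gen r k ranks b)⁻¹) ∧ l.prod = x}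

section Words
variable {X : Type}

/-- Words in signed letters. -/
abbrev Wd (X : Type) := List (X × Bool)

/-- inverse of a signed letter -/
def ng (p : X × Bool) : X × Bool := (p.1, !p.2)

@[simp] lemma ng_ng (p : X × Bool) : ng (ng p) = p := by simp [ng]
lemma ng_ne (p : X × Bool) : ng p ≠ p := by
  rcases p with ⟨x, b⟩; cases b <;> simp [ng]
@[simp] lemma ng_fst (p : X × Bool) : (ng p).1 = p.1 := rfl

/-- value of a signed letter -/
def lv {Γ : Type} [Group Γ] (f : X → Γ) (p : X × Bool) : Γ := if p.2 then f p.1 else (f p.1)⁻¹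

/-- value of a word -/
def ev {Γ : Type} [Group Γ] (f : X → Γ) (w : Wd X) : Γ := (w.map (lv f)).prod

variable {Γ : Type} [Group Γ]

@[simp] lemma lv_ng (f : X → Γ) (p : X × Bool) : lv f (ng p) = (lv f p)⁻¹ := by
  rcases p with ⟨x, b⟩; cases b <;> simp [ng, lv]
@[simp] lemma ev_nil (f : X → Γ) : ev f [] = 1 := rfl
@[simp] lemma ev_cons (f : X → Γ) (p) (w : Wd X) : ev f (p :: w) = lv f p * ev f w := by simp [ev]
@[simp] lemma ev_append (f : X → Γ) (u w : Wd X) : ev f (u ++ w) = ev f u * ev f w := by simp [ev]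

/-- formal inverse of a word -/
def iw (w : Wd X) : Wd X := (w.map ng).reverse

@[simp] lemma iw_length (w : Wd X) : (iw w).length = w.length := by simp [iw]
@[simp] lemma mem_iw (w : Wd X) (p) : p ∈ iw w ↔ ng p ∈ w := by
  simp only [iw, List.mem_reverse, List.mem_map]
  constructor
  · rintro ⟨q, hq, rfl⟩; simpa using hq
  · intro h; exact ⟨_, h, by simp⟩
@[simp] lemma ev_iw (f : X → Γ) (w : Wd X) : ev f (iw w) = (ev f w)⁻¹ := by
  induction w with
  | nil => simp [iw]
  | cons p w ih =>
    have : iw (p :: w) = iw w ++ [ng p] := by simp [iw]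
    rw [this]; simp [ih]

lemma ev_congr {f f' : X → Γ} {w : Wd X} (h : ∀ p ∈ w, f p.1 = f' p.1) : ev f w = ev f' w := by
  unfold ev
  congr 1
  apply List.map_congr_left
  intro p hp
  simp [lv, h p hp]

open Classical in
/-- change the value of one signed letter -/
noncomputable def upd (f : X → Γ) (p : X × Bool) (v : Γ) : X → Γ :=
  Function.update f p.1 (if p.2 then v else v⁻¹)

@[simp] lemma lv_upd_self (f : X → Γ) (p : X × Bool) (v : Γ) : lv (upd f p v) p = v := by
  rcases p with ⟨x, b⟩; cases b <;> simp [upd, lv]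

lemma lv_upd_of_ne (f : X → Γ) (p q : X × Bool) (v : Γ) (h : q ≠ p) (h' : q ≠ ng p) :
    lv (upd f p v) q = lv f q := by
  have : q.1 ≠ p.1 := by
    intro e
    rcases p with ⟨x, b⟩; rcases q with ⟨y, c⟩
    simp only at e; subst e
    cases b <;> cases c <;> simp_all [ng]
  simp [lv, upd, Function.update, this]

lemma ev_upd (f : X → Γ) (p : X × Bool) (v : Γ) {w : Wd X} (h : p ∉ w) (h' : ng p ∉ w) :
    ev (upd f p v) w = ev f w := by
  unfold ev
  congr 1
  apply List.map_congr_left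
  intro q hq
  apply lv_upd_of_ne
  · rintro rfl; exact h hq
  · rintro rfl; exact h' hq

/-- orientable quadratic: every signed letter at most once, closed under inversion -/
def Quad (T : Wd X) : Prop := T.Nodup ∧ ∀ p ∈ T, ng p ∈ T

lemma Quad.perm {T T' : Wd X} (h : Quad T) (hp : T.Perm T') : Quad T' :=
  ⟨hp.nodup_iff.1 h.1, fun p hm => hp.mem_iff.1 (h.2 p (hp.mem_iff.2 hm))⟩

lemma Quad.drop {p} {T : Wd X} (h : Quad (p :: ng p :: T)) : Quad T ∧ p ∉ T ∧ ng p ∉ T := by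
  obtain ⟨h1, h2⟩ := h
  simp only [List.nodup_cons, List.mem_cons, not_or] at h1
  refine ⟨⟨h1.2.2, fun q hq => ?_⟩, h1.1.2, h1.2.1⟩
  have := h2 q (by simp [hq])
  simp only [List.mem_cons] at this
  rcases this with h | h | h
  · exfalso; apply h1.2.1; rw [← h]; simpa using hq
  · exfalso; apply h1.1.2
    have : q = p := by rw [← ng_ng q, h, ng_ng]
    exact this ▸ hq
  · exact h

/-! ### Phase A : eliminate variable letters from the blocks -/

/-- A block: letters of a common type, value one. -/
def Good {I : Type} (θ : X → Γ) (typ : X → I) (B : Wd X) : Prop :=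
  (∀ p ∈ B, ∀ q ∈ B, typ p.1 = typ q.1) ∧ ev θ B = 1

lemma ev_commute {I : Type} (θ : X → Γ) (typ : X → I)
    (hc : ∀ x y, typ x = typ y → Commute (θ x) (θ y)) (u w : Wd X)
    (h : ∀ p ∈ u, ∀ q ∈ w, typ p.1 = typ q.1) : Commute (ev θ u) (ev θ w) := by
  unfold ev
  apply Commute.list_prod_left
  intro a ha
  apply Commute.list_prod_right
  intro b hb
  simp only [List.mem_map] at ha hb
  obtain ⟨p, hp, rfl⟩ := ha
  obtain ⟨q, hq, rfl⟩ := hb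
  have := hc _ _ (h p hp q hq)
  unfold lv
  split_ifs <;> simp [this]

theorem phaseA {I : Type} (θ : X → Γ) (typ : X → I)
    (hc : ∀ x y, typ x = typ y → Commute (θ x) (θ y)) (Ds : List (Wd X)) :
    ∀ (n : ℕ) (Bs : List (Wd X)), Bs.flatten.length ≤ n →
      (∀ B ∈ Bs, Good θ typ B) → Quad (Bs.flatten ++ Ds.flatten) →
      ∃ Bs' : List (Wd X), (∀ B ∈ Bs', Good θ typ B) ∧ Quad (Bs'.flatten ++ Ds.flatten) ∧
        (∀ p ∈ Bs'.flatten, ng p ∈ Ds.flatten) ∧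
        ∀ (Δ : Type) [Group Δ] (f : X → Δ), (∀ B ∈ Bs', ev f B = 1) →
          ∃ f' : X → Δ, (∀ B ∈ Bs, ev f' B = 1) ∧ ∀ D ∈ Ds, ev f' D = ev f D := by
  intro n
  induction n with
  | zero =>
    intro Bs hn hg hq
    refine ⟨Bs, hg, hq, ?_, fun Δ _ f h => ⟨f, h, fun _ _ => rfl⟩⟩
    intro p hp
    rw [List.eq_nil_of_length_eq_zero (Nat.le_zero.1 hn)] at hp
    simp at hp
  | succ n ih =>
    intro Bs hn hg hq
    by_cases hex : ∃ p ∈ Bs.flatten, ng p ∉ Ds.flatten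
    swap
    · push Not at hex
      exact ⟨Bs, hg, hq, hex, fun Δ _ f h => ⟨f, h, fun _ _ => rfl⟩⟩
    obtain ⟨p, hp, hpD⟩ := hex
    have hp' : ng p ∈ Bs.flatten := by
      have := hq.2 p (by simp only [List.mem_append]; exact Or.inl hp)
      simp only [List.mem_append] at this
      exact this.resolve_right hpD
    obtain ⟨B1, hB1, hpB1⟩ := List.mem_flatten.1 hp
    obtain ⟨U, V, rfl⟩ := List.append_of_mem hB1
    by_cases hin : ng p ∈ B1
    · -- both occurrences in the same block
      have key : ∃ (v u w : Wd X) (a : X × Bool), B1 = v ++ a :: (u ++ ng a :: w) := by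
        obtain ⟨v, w, rfl⟩ := List.append_of_mem hpB1
        simp only [List.mem_append, List.mem_cons] at hin
        rcases hin with h | h | h
        · obtain ⟨v1, v2, rfl⟩ := List.append_of_mem h
          exact ⟨v1, v2, w, ng p, by simp⟩
        · exact absurd h (ng_ne p)
        · obtain ⟨v1, v2, rfl⟩ := List.append_of_mem h
          exact ⟨v, v1, v2, p, by simp⟩
      obtain ⟨v, u, w, a, rfl⟩ := key
      have hperm : ((U ++ (v ++ a :: (u ++ ng a :: w)) :: V).flatten ++ Ds.flatten).Perm
          (a :: ng a :: ((U ++ (v ++ u ++ w) :: V).flatten ++ Ds.flatten)) := by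
        classical
        rw [List.perm_iff_count]; intro z
        simp only [List.flatten_append, List.flatten_cons, List.count_append, List.count_cons]
        omega
      obtain ⟨hq', ha, ha'⟩ := (hq.perm hperm).drop
      have hgB := hg (v ++ a :: (u ++ ng a :: w)) (by simp)
      obtain ⟨Bs', h1, h2, h3, h4⟩ := ih (U ++ (v ++ u ++ w) :: V) (by
          simp only [List.flatten_append, List.flatten_cons, List.length_append,
            List.length_cons] at hn ⊢
          omega) (by
          intro B hB
          simp only [List.mem_append, List.mem_cons] at hB
          rcases hB with h | h | h
          · exact hg B (by simp [h])
          · subst h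
            constructor
            · intro p hp q hq
              simp only [List.mem_append] at hp hq
              apply hgB.1 p _ q
              · simp; tauto
              · simp; tauto
            · have hcom : Commute (lv θ a) (ev θ u) := by
                have := ev_commute θ typ hc [a] u (by
                  intro p hp q hq
                  apply hgB.1 p _ q
                  · simp [hq]
                  · simp at hp; simp [hp])
                simpa using this
              have h5 := hgB.2
              simp only [ev_append, ev_cons, lv_ng] at h5 ⊢
              rw [← h5]
              have : lv θ a * (ev θ u * ((lv θ a)⁻¹ * ev θ w)) = ev θ u * ev θ w := by
                rw [← mul_assoc, hcom.eq]; group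
              rw [this]; group
          · exact hg B (by simp [h])) hq'
      refine ⟨Bs', h1, h2, h3, ?_⟩
      intro Δ _ f hf
      obtain ⟨f', h5, h6⟩ := h4 Δ f hf
      simp only [List.flatten_append, List.flatten_cons, List.mem_append, not_or,
        List.mem_flatten, not_exists, not_and] at ha ha'
      refine ⟨upd f' a 1, ?_, ?_⟩
      · intro B hB
        simp only [List.mem_append, List.mem_cons] at hB
        rcases hB with h | h | h
        · rw [ev_upd _ _ _ (ha.1.1 B h) (ha'.1.1 B h)]; exact h5 B (by simp [h])
        · subst h
          have := h5 (v ++ u ++ w) (by simp)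
          simp only [ev_append, ev_cons, lv_ng, lv_upd_self] at this ⊢
          rw [ev_upd _ _ _ ha.1.2.1.1.1 ha'.1.2.1.1.1, ev_upd _ _ _ ha.1.2.1.1.2 ha'.1.2.1.1.2,
            ev_upd _ _ _ ha.1.2.1.2 ha'.1.2.1.2]
          simpa [mul_assoc] using this
        · rw [ev_upd _ _ _ (ha.1.2.2 B h) (ha'.1.2.2 B h)]; exact h5 B (by simp [h])
      · intro D hD
        rw [ev_upd _ _ _ (ha.2 D hD) (ha'.2 D hD)]; exact h6 D hD
    · -- the inverse is in another block
      obtain ⟨B2, hB2, hpB2⟩ := List.mem_flatten.1 hp'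
      have hB2' : B2 ∈ U ++ V := by
        simp only [List.mem_append, List.mem_cons] at hB2 ⊢
        rcases hB2 with h | h | h
        · exact Or.inl h
        · subst h; exact absurd hpB2 hin
        · exact Or.inr h
      obtain ⟨U', V', hUV⟩ := List.append_of_mem hB2'
      obtain ⟨v, w, rfl⟩ := List.append_of_mem hpB1
      obtain ⟨s, t, rfl⟩ := List.append_of_mem hpB2
      have hmemU : ∀ B, B ∈ U ++ (v ++ p :: w) :: V ↔
          B = v ++ p :: w ∨ B = s ++ ng p :: t ∨ B ∈ U' ++ V' := by
        intro B
        have : B ∈ U ++ V ↔ B ∈ U' ++ (s ++ ng p :: t) :: V' := by rw [hUV]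
        simp only [List.mem_append, List.mem_cons] at this ⊢
        tauto
      have hperm : ((U ++ (v ++ p :: w) :: V).flatten ++ Ds.flatten).Perm
          (p :: ng p :: (((s ++ w ++ v ++ t) :: (U' ++ V')).flatten ++ Ds.flatten)) := by
        classical
        rw [List.perm_iff_count]; intro z
        have := congrArg (fun l => (List.flatten l).count z) hUV
        simp only [List.flatten_append, List.flatten_cons, List.count_append,
          List.count_cons] at this ⊢
        omega
      obtain ⟨hq', ha, ha'⟩ := (hq.perm hperm).drop
      have hgB1 := hg (v ++ p :: w) (by simp)
      have hgB2 := hg (s ++ ng p :: t) ((hmemU _).2 (by simp))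
      have hty1 : ∀ q ∈ v ++ p :: w, typ q.1 = typ p.1 := fun q hq => hgB1.1 q hq p (by simp)
      have hty2 : ∀ q ∈ s ++ ng p :: t, typ q.1 = typ p.1 :=
        fun q hq => hgB2.1 q hq (ng p) (by simp)
      have hlen := hperm.length_eq
      obtain ⟨Bs', h1, h2, h3, h4⟩ := ih ((s ++ w ++ v ++ t) :: (U' ++ V')) (by
          simp only [List.length_append, List.length_cons] at hn hlen ⊢
          omega) (by
          intro B hB
          simp only [List.mem_cons] at hB
          rcases hB with h | h
          · subst h
            constructor
            · have : ∀ q ∈ s ++ w ++ v ++ t, typ q.1 = typ p.1 := by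
                intro q hq
                simp only [List.mem_append] at hq
                rcases hq with ((h | h) | h) | h
                · exact hty2 q (by simp [h])
                · exact hty1 q (by simp [h])
                · exact hty1 q (by simp [h])
                · exact hty2 q (by simp [h])
              intro q hq q' hq'
              rw [this q hq, this q' hq']
            · have e1 := hgB1.2
              have e2 := hgB2.2
              simp only [ev_append, ev_cons, lv_ng] at e1 e2 ⊢
              have e3 : lv θ p = (ev θ v)⁻¹ * (ev θ w)⁻¹ := by
                calc lv θ p = (ev θ v)⁻¹ * (ev θ v * (lv θ p * ev θ w)) * (ev θ w)⁻¹ := by group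
                  _ = _ := by rw [e1]; group
              rw [e3] at e2
              rw [← e2]; group
          · exact hg B ((hmemU B).2 (Or.inr (Or.inr h)))) hq'
      refine ⟨Bs', h1, h2, h3, ?_⟩
      intro Δ _ f hf
      obtain ⟨f', h5, h6⟩ := h4 Δ f hf
      simp only [List.flatten_cons, List.mem_append, not_or,
        List.mem_flatten, not_exists, not_and] at ha ha'
      refine ⟨upd f' p ((ev f' v)⁻¹ * (ev f' w)⁻¹), ?_, ?_⟩
      · intro B hB
        have hv := ev_upd f' p ((ev f' v)⁻¹ * (ev f' w)⁻¹) ha.1.1.1.2 ha'.1.1.1.2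
        have hw := ev_upd f' p ((ev f' v)⁻¹ * (ev f' w)⁻¹) ha.1.1.1.1.2 ha'.1.1.1.1.2
        have hs := ev_upd f' p ((ev f' v)⁻¹ * (ev f' w)⁻¹) ha.1.1.1.1.1 ha'.1.1.1.1.1
        have ht := ev_upd f' p ((ev f' v)⁻¹ * (ev f' w)⁻¹) ha.1.1.2 ha'.1.1.2
        rcases (hmemU B).1 hB with h | h | h
        · subst h
          simp only [ev_append, ev_cons, lv_upd_self, hv, hw]
          group
        · subst h
          have := h5 (s ++ w ++ v ++ t) (by simp)
          simp only [ev_append, ev_cons, lv_ng, lv_upd_self, hs, ht] at this ⊢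
          rw [← this]; group
        · rw [ev_upd _ _ _ (ha.1.2 B (List.mem_append.1 h)) (ha'.1.2 B (List.mem_append.1 h))]
          exact h5 B (List.mem_cons_of_mem _ h)
      · intro D hD
        rw [ev_upd _ _ _ (ha.2 D hD) (ha'.2 D hD)]; exact h6 D hD

/-! ### Phase B : substitute the blocks into the coefficients -/

theorem phaseB (θ : X → Γ) :
    ∀ (Bs Ds : List (Wd X)), (∀ B ∈ Bs, ev θ B = 1) → Quad (Bs.flatten ++ Ds.flatten) →
      (∀ p ∈ Bs.flatten, ng p ∈ Ds.flatten) →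
      ∃ Ds' : List (Wd X), Quad Ds'.flatten ∧ Ds'.map (ev θ) = Ds.map (ev θ) ∧
        Ds'.flatten.length ≤ Ds.flatten.length + Bs.flatten.length ∧
        ∀ (Δ : Type) [Group Δ] (f : X → Δ),
          ∃ f' : X → Δ, (∀ B ∈ Bs, ev f' B = 1) ∧ Ds.map (ev f') = Ds'.map (ev f) := by
  intro Bs
  induction Bs with
  | nil =>
    intro Ds _ hq _
    exact ⟨Ds, by simpa using hq, rfl, by simp, fun Δ _ f => ⟨f, by simp, rfl⟩⟩
  | cons B Bs ih =>
    intro Ds hB hq hD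
    rcases B with _ | ⟨p, w⟩
    · obtain ⟨Ds', h1, h2, h3, h4⟩ := ih Ds (fun B h => hB B (by simp [h])) (by simpa using hq)
        (by simpa using hD)
      refine ⟨Ds', h1, h2, by simpa using h3, ?_⟩
      intro Δ _ f
      obtain ⟨f', h5, h6⟩ := h4 Δ f
      exact ⟨f', by simpa using h5, h6⟩
    · obtain ⟨D, hDm, hpD⟩ := List.mem_flatten.1 (hD p (by simp))
      obtain ⟨U, V, rfl⟩ := List.append_of_mem hDm
      obtain ⟨a, b, rfl⟩ := List.append_of_mem hpD
      have hperm : (((p :: w) :: Bs).flatten ++ (U ++ (a ++ ng p :: b) :: V).flatten).Perm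
          (p :: ng p :: (Bs.flatten ++ (U ++ (a ++ w ++ b) :: V).flatten)) := by
        classical
        rw [List.perm_iff_count]; intro z
        simp only [List.flatten_append, List.flatten_cons, List.count_append, List.count_cons]
        omega
      obtain ⟨hq', ha, ha'⟩ := (hq.perm hperm).drop
      obtain ⟨Ds', h1, h2, h3, h4⟩ := ih (U ++ (a ++ w ++ b) :: V) (fun B h => hB B (by simp [h]))
        hq' (by
          intro q hq0
          have h1 := hD q (by simp only [List.flatten_cons, List.mem_append]; exact Or.inr hq0)
          have h2 : ng q ≠ ng p := by
            intro e
            have : q = p := by rw [← ng_ng q, e, ng_ng]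
            subst this
            exact ha (List.mem_append_left _ hq0)
          simp only [List.flatten_append, List.flatten_cons, List.mem_append, List.mem_cons] at h1 ⊢
          tauto)
      simp only [List.flatten_append, List.flatten_cons, List.mem_append, not_or,
        List.mem_flatten, not_exists, not_and] at ha ha'
      have hw : ev θ w = (lv θ p)⁻¹ := by
        have := hB (p :: w) (by simp)
        rw [ev_cons] at this
        exact eq_inv_of_mul_eq_one_right this
      refine ⟨Ds', h1, ?_, ?_, ?_⟩
      · rw [h2]; simp [hw]
      · simp only [List.flatten_append, List.flatten_cons, List.length_append,
          List.length_cons] at h3 ⊢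
        omega
      · intro Δ _ f
        obtain ⟨f', h5, h6⟩ := h4 Δ f
        have hu : ∀ w', p ∉ w' → ng p ∉ w' → ev (upd f' p (ev f' w)⁻¹) w' = ev f' w' :=
          fun w' h h' => ev_upd _ _ _ h h'
        have hww := hu w ha.2.2.1.1.2 ha'.2.2.1.1.2
        refine ⟨upd f' p (ev f' w)⁻¹, ?_, ?_⟩
        · intro B hB
          simp only [List.mem_cons] at hB
          rcases hB with h | h
          · subst h; simp [hww]
          · rw [hu B (ha.1 B h) (ha'.1 B h)]; exact h5 B h
        · rw [← h6]
          simp only [List.map_append, List.map_cons, ev_append, ev_cons, lv_ng, lv_upd_self, inv_inv]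
          rw [hu a ha.2.2.1.1.1 ha'.2.2.1.1.1, hu b ha.2.2.1.2 ha'.2.2.1.2,
            List.map_congr_left (fun D h => hu D (ha.2.1 D h) (ha'.2.1 D h)),
            List.map_congr_left (l := V) (fun D h => hu D (ha.2.2.2 D h) (ha'.2.2.2 D h)), mul_assoc]

end Words

/-! ### Heisenberg-type group -/

/-- Pairs (vector, bilinear form) with a Heisenberg-type product. -/
@[ext] structure Heis (ι : Type) where
  v : ι → ℚ
  M : ι → ι → ℚ

namespace Heis
variable {ι : Type}

noncomputable instance : Group (Heis ι) where
  mul a b := ⟨fun i => a.v i + b.v i, fun i j => a.M i j + b.M i j + a.v i * b.v j⟩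
  one := ⟨fun _ => 0, fun _ _ => 0⟩
  inv a := ⟨fun i => - a.v i, fun i j => - a.M i j + a.v i * a.v j⟩
  mul_assoc a b c := by
    apply Heis.ext
    · funext i; exact add_assoc _ _ _
    · funext i j
      show (a.M i j + b.M i j + a.v i * b.v j) + c.M i j + (a.v i + b.v i) * c.v j =
        a.M i j + (b.M i j + c.M i j + b.v i * c.v j) + a.v i * (b.v j + c.v j)
      ring
  one_mul a := by
    apply Heis.ext
    · funext i; exact zero_add _
    · funext i j
      show 0 + a.M i j + 0 * a.v j = a.M i j
      ring
  mul_one a := by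
    apply Heis.ext
    · funext i; exact add_zero _
    · funext i j
      show a.M i j + 0 + a.v i * 0 = a.M i j
      ring
  inv_mul_cancel a := by
    apply Heis.ext
    · funext i; exact neg_add_cancel _
    · funext i j
      show (- a.M i j + a.v i * a.v j) + a.M i j + (- a.v i) * a.v j = 0
      ring

@[simp] lemma mul_v (a b : Heis ι) (i) : (a * b).v i = a.v i + b.v i := rfl
@[simp] lemma mul_M (a b : Heis ι) (i j) : (a * b).M i j = a.M i j + b.M i j + a.v i * b.v j := rfl
@[simp] lemma one_v (i) : (1 : Heis ι).v i = 0 := rfl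
@[simp] lemma one_M (i j) : (1 : Heis ι).M i j = 0 := rfl
@[simp] lemma inv_v (a : Heis ι) (i) : (a⁻¹).v i = - a.v i := rfl
@[simp] lemma inv_M (a : Heis ι) (i j) : (a⁻¹).M i j = - a.M i j + a.v i * a.v j := rfl

lemma list_prod (l : List (Heis ι)) (h : ∀ a ∈ l, ∀ i, a.v i = 0) (i j) :
    l.prod.v i = 0 ∧ l.prod.M i j = (l.map (fun a => a.M i j)).sum := by
  induction l with
  | nil => simp
  | cons a l ih =>
    have := ih (fun b hb => h b (by simp [hb]))
    simp [this.1, this.2, h a (by simp)]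

end Heis

/-- The standard alternating form with `n` hyperbolic planes. -/
def Jf : ℕ → (ℕ × Bool) → (ℕ × Bool) → ℚ
  | 0 => fun _ _ => 0
  | n + 1 => fun i j => Jf n i j +
      ((if i = (n, false) then 1 else 0) * (if j = (n, true) then 1 else 0) -
       (if i = (n, true) then 1 else 0) * (if j = (n, false) then 1 else 0))

lemma Jf_apply (n : ℕ) (i j : ℕ × Bool) : Jf n i j =
    if i.1 < n ∧ j = (i.1, !i.2) then (if i.2 then -1 else 1) else 0 := by
  induction n with
  | zero => simp [Jf]
  | succ n ih =>
    simp only [Jf, ih]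
    rcases i with ⟨i, a⟩; rcases j with ⟨j, b⟩
    rcases lt_trichotomy i n with h | h | h
    · cases a <;> cases b <;> simp [h.ne, h, Nat.lt_succ_of_lt h]
    · subst h; by_cases hj : j = i <;> cases a <;> cases b <;> simp [hj]
    · cases a <;> cases b <;> simp [h.ne', not_lt.2 h.le, not_lt.2 (Nat.succ_le_of_lt h)]

lemma mat_rank_add_le {ι : Type} [Fintype ι] [DecidableEq ι] (A B : Matrix ι ι ℚ) :
    (A + B).rank ≤ A.rank + B.rank := by
  unfold Matrix.rank
  rw [Matrix.mulVecLin_add]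
  refine (Submodule.finrank_mono (LinearMap.range_add_le _ _)).trans ?_
  exact Submodule.finrank_add_le_finrank_add_finrank _ _

lemma rank_bound (n g : ℕ) (x y : Fin g → (ℕ × Bool) → ℚ)
    (h : ∀ i j, ∑ t, (x t i * y t j - y t i * x t j) = Jf n i j) : n ≤ g := by
  classical
  let emb : Fin n × Bool → ℕ × Bool := fun p => (p.1, p.2)
  let J : Matrix (Fin n × Bool) (Fin n × Bool) ℚ := fun i j => Jf n (emb i) (emb j)
  have h1 : J = ∑ t, (Matrix.vecMulVec (x t ∘ emb) (y t ∘ emb) +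
      Matrix.vecMulVec (-(y t ∘ emb)) (x t ∘ emb)) := by
    ext i j
    simp only [J, ← h, Matrix.sum_apply, Matrix.add_apply, Matrix.vecMulVec_apply]
    apply Finset.sum_congr rfl
    intro t _
    simp; ring
  have h2 : J.rank ≤ 2 * g := by
    rw [h1]
    have : ∀ s : Finset (Fin g), (∑ t ∈ s, (Matrix.vecMulVec (x t ∘ emb) (y t ∘ emb) +
      Matrix.vecMulVec (-(y t ∘ emb)) (x t ∘ emb))).rank ≤ 2 * s.card := by
      intro s
      induction s using Finset.induction_on with
      | empty => simp
      | insert a s ha ih =>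
        rw [Finset.sum_insert ha, Finset.card_insert_of_notMem ha]
        refine (mat_rank_add_le _ _).trans ?_
        have h3 := mat_rank_add_le (Matrix.vecMulVec (x a ∘ emb) (y a ∘ emb))
          (Matrix.vecMulVec (-(y a ∘ emb)) (x a ∘ emb))
        have h4 := Matrix.rank_vecMulVec_le (x a ∘ emb) (y a ∘ emb)
        have h5 := Matrix.rank_vecMulVec_le (-(y a ∘ emb)) (x a ∘ emb)
        omega
    simpa using this Finset.univ
  have h3 : J * (-J) = 1 := by
    ext ⟨i, a⟩ ⟨j, b⟩
    rw [Matrix.mul_apply, Finset.sum_eq_single (i, !a)]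
    · rw [Matrix.neg_apply, Matrix.one_apply]
      simp only [J, emb, Jf_apply]
      by_cases hij : i = j
      · subst hij; cases a <;> cases b <;> simp
      · have : (j : ℕ) ≠ i := fun e => hij (Fin.ext e.symm)
        cases a <;> cases b <;> simp [this, hij]
    · rintro ⟨k, c⟩ _ hne
      have : J (i, a) (k, c) = 0 := by
        simp only [J, emb, Jf_apply]
        rw [if_neg]
        rintro ⟨_, e⟩
        apply hne
        simp only [Prod.mk.injEq] at e ⊢
        exact ⟨Fin.ext e.1, e.2⟩
      rw [this, zero_mul]
    · simp
  have h4 : J.rank = 2 * n := by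
    have : IsUnit J := IsUnit.of_mul_eq_one _ h3
    rw [Matrix.rank_of_isUnit _ this]
    simp [mul_comm]
  omega

/-! ### Phase C -/

section PhaseC
variable {X : Type} {Γ : Type} [Group Γ]

/-- Items: commutators and conjugated coefficients. -/
abbrev Item (Γ : Type) := (Γ × Γ) ⊕ (Γ × Γ)

/-- value of an item -/
def ival : Item Γ → Γ
  | Sum.inl (x, y) => x⁻¹ * y⁻¹ * x * y
  | Sum.inr (d, z) => z⁻¹ * d * z

lemma pattern (R : Wd X) (hne : R ≠ []) (hq : Quad R) :
    (∃ c a h, R = c ++ a :: ng a :: h) ∨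
    ∃ c a d b e f h, R = c ++ a :: (d ++ b :: (e ++ ng a :: (f ++ ng b :: h))) := by
  have hex : ∃ n, ∃ c a d h, R = c ++ a :: (d ++ ng a :: h) ∧ d.length = n := by
    obtain ⟨a, R', rfl⟩ := List.exists_cons_of_ne_nil hne
    have := hq.2 a (by simp)
    simp only [List.mem_cons] at this
    obtain ⟨d, h, rfl⟩ := List.append_of_mem (this.resolve_left (ng_ne a))
    exact ⟨_, [], a, d, h, rfl, rfl⟩
  classical
  obtain ⟨c, a, d, h, hR, hd⟩ := Nat.find_spec hex
  have hmin := fun m hm => Nat.find_min hex (m := m) hm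
  rw [← hd] at hmin
  rcases d with _ | ⟨b, d⟩
  · exact Or.inl ⟨c, a, h, by simpa using hR⟩
  right
  have hb := hq.2 b (by rw [hR]; simp)
  have hnd := hq.1
  rw [hR] at hb hnd
  simp only [List.mem_append, List.mem_cons, List.cons_append] at hb
  have hdup : ∀ q, (c ++ a :: (b :: d ++ ng a :: h)).count q ≤ 1 :=
    fun q => List.nodup_iff_count_le_one.1 hnd q
  rcases hb with hb | hb | hb | hb | hb | hb
  · obtain ⟨c1, c2, rfl⟩ := List.append_of_mem hb
    exact ⟨c1, ng b, c2, a, [], d, h, by rw [hR]; simp⟩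
  · exfalso
    have := hdup (ng a)
    rw [← hb] at this
    simp only [ng_ng, List.count_append, List.count_cons, List.cons_append] at this
    simp at this
    first | done | omega
  · exact absurd hb (ng_ne b)
  · obtain ⟨d1, d2, rfl⟩ := List.append_of_mem hb
    exfalso
    refine hmin d1.length (by simp only [List.length_cons, List.length_append]; omega) ⟨c ++ [a], b, d1, d2 ++ ng a :: h, ?_, rfl⟩
    rw [hR]; simp
  · exfalso
    have e : b = a := by rw [← ng_ng b, hb, ng_ng]
    have := hdup a
    rw [e] at this
    simp only [List.count_append, List.count_cons, List.cons_append] at this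
    simp at this
    omega
  · obtain ⟨f, h', rfl⟩ := List.append_of_mem hb
    exact ⟨c, a, [], b, d, f, h', by rw [hR]; simp⟩

lemma handle_id (a b c d e f h x y : Γ) (ha : a = x⁻¹ * f * e)
    (hb : b = d⁻¹ * e⁻¹ * f⁻¹ * y⁻¹ * f) :
    c * (a * (d * (b * (e * (a⁻¹ * (f * (b⁻¹ * h))))))) =
      c * (x⁻¹ * y⁻¹ * x * y) * (f * (e * (d * h))) := by
  subst ha hb; group

/-- The data produced by phase C. -/
def Out (θ : X → Γ) (ℓ : Γ → ℕ) (K : ℕ) (R : Wd X) (Ds : List (Wd X)) : Prop :=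
  ∃ (I : List (Item Γ)) (n : ℕ),
    ev θ R * (I.map ival).prod = 1 ∧
    (I.filterMap Sum.getLeft?).length = n ∧
    ((I.filterMap Sum.getRight?).map Prod.fst).Perm (Ds.map (ev θ)) ∧
    (∀ x y, Sum.inl (x, y) ∈ I → ℓ x ≤ K ∧ ℓ y ≤ K) ∧
    (∀ d z, Sum.inr (d, z) ∈ I → ℓ z ≤ K) ∧
    ∃ ψ : X → Heis (ℕ × Bool), (∀ D ∈ R :: Ds, ∀ i, (ev ψ D).v i = 0) ∧
      ∀ i j, ((R :: Ds).map (fun D => (ev ψ D).M i j)).sum = Jf n i j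

lemma ev_len (θ : X → Γ) (ℓ : Γ → ℕ) (h1 : ℓ 1 = 0) (hm : ∀ a b, ℓ (a * b) ≤ ℓ a + ℓ b)
    (hi : ∀ a, ℓ a⁻¹ = ℓ a) (hθ : ∀ x, ℓ (θ x) ≤ 1) (w : Wd X) : ℓ (ev θ w) ≤ w.length := by
  induction w with
  | nil => simp [h1]
  | cons p w ih =>
    have : ℓ (lv θ p) ≤ 1 := by unfold lv; split_ifs <;> simp [hi, hθ]
    have := hm (lv θ p) (ev θ w)
    simp only [ev_cons, List.length_cons]; omega

theorem phaseC (θ : X → Γ) (ℓ : Γ → ℕ) (h1 : ℓ 1 = 0) (hm : ∀ a b, ℓ (a * b) ≤ ℓ a + ℓ b)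
    (hi : ∀ a, ℓ a⁻¹ = ℓ a) (hθ : ∀ x, ℓ (θ x) ≤ 1) (L : ℕ) :
    ∀ (N : ℕ) (R : Wd X) (Ds : List (Wd X)), R.length + Ds.flatten.length + Ds.length ≤ N →
      R.length + Ds.flatten.length ≤ L →
      Quad (R ++ Ds.flatten) → Out θ ℓ (2 * L) R Ds := by
  have hl := ev_len θ ℓ h1 hm hi hθ
  intro N
  induction N with
  | zero =>
    intro R Ds hN hL hq
    have hR : R = [] := List.eq_nil_of_length_eq_zero (by omega)
    have hD : Ds = [] := List.eq_nil_of_length_eq_zero (by omega)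
    subst hR hD
    exact ⟨[], 0, by simp, by simp, by simp, by simp, by simp, fun _ => 1, by simp, by simp [Jf]⟩
  | succ N ih =>
    intro R Ds hN hL hq
    by_cases hR : R = []
    · subst hR
      rcases Ds with _ | ⟨D, Ds⟩
      · exact ih [] [] (by simp) (by simp) hq
      · simp only [List.length_nil, List.flatten_cons, List.length_cons, List.length_append] at hN hL
        obtain ⟨I, n, e1, e2, e3, e4, e5, ψ, e6, e7⟩ := ih D Ds (by omega) (by omega)
          (by simpa using hq)
        refine ⟨Sum.inr (ev θ D, 1) :: I, n, ?_, ?_, ?_, ?_, ?_, ψ, ?_, ?_⟩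
        · simpa [ival] using e1
        · simpa [List.filterMap_cons] using e2
        · simpa [List.filterMap_cons] using e3
        · intro x y h; exact e4 x y (by simpa using h)
        · intro d z h
          simp only [List.mem_cons, Sum.inr.injEq, Prod.mk.injEq] at h
          rcases h with ⟨_, rfl⟩ | h
          · simp [h1]
          · exact e5 d z h
        · intro D' hD' i
          rcases List.mem_cons.1 hD' with rfl | h
          · simp
          · exact e6 D' h i
        · intro i j; rw [← e7]; simp
    by_cases hmerge : ∃ q ∈ R, ng q ∈ Ds.flatten
    · -- merge
      obtain ⟨q, hqR, hqD⟩ := hmerge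
      obtain ⟨D, hD, hqD'⟩ := List.mem_flatten.1 hqD
      obtain ⟨U, V, rfl⟩ := List.append_of_mem hD
      obtain ⟨a, b, rfl⟩ := List.append_of_mem hqD'
      obtain ⟨c, d, rfl⟩ := List.append_of_mem hqR
      have hperm : ((c ++ q :: d) ++ (U ++ (a ++ ng q :: b) :: V).flatten).Perm
          (q :: ng q :: ((c ++ b ++ a ++ d) ++ (U ++ V).flatten)) := by
        classical
        rw [List.perm_iff_count]; intro z
        simp only [List.flatten_append, List.flatten_cons, List.count_append, List.count_cons]
        omega
      obtain ⟨hq', ha, ha'⟩ := (hq.perm hperm).drop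
      simp only [List.flatten_append, List.flatten_cons, List.length_append,
          List.length_cons] at hN hL
      obtain ⟨I, n, e1, e2, e3, e4, e5, ψ, e6, e7⟩ := ih (c ++ b ++ a ++ d) (U ++ V)
        (by simp only [List.flatten_append, List.length_append]; omega)
        (by simp only [List.flatten_append, List.length_append]; omega) hq'
      refine ⟨Sum.inr (ev θ (a ++ ng q :: b), ev θ (a ++ d)) :: I, n, ?_, ?_, ?_, ?_, ?_, ?_⟩
      · rw [← e1]
        simp only [List.map_cons, List.prod_cons, ival, ev_append, ev_cons, lv_ng]
        group
      · simpa [List.filterMap_cons] using e2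
      · simp only [List.filterMap_cons, Sum.getRight?_inr, List.map_cons, List.map_append]
        refine (List.Perm.cons _ e3).trans ?_
        rw [List.map_append]
        exact List.perm_middle.symm
      · intro x y h; exact e4 x y (by simpa using h)
      · intro d' z h
        simp only [List.mem_cons, Sum.inr.injEq, Prod.mk.injEq] at h
        rcases h with ⟨_, rfl⟩ | h
        · have := hl (a ++ d)
          simp only [List.length_append] at this
          omega
        · exact e5 d' z h
      · simp only [List.flatten_append, List.mem_append, not_or,
          List.mem_flatten, not_exists, not_and] at ha ha'
        set v := ev ψ b * ev ψ a with hv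
        have hu : ∀ w', q ∉ w' → ng q ∉ w' → ev (upd ψ q v) w' = ev ψ w' :=
          fun w' h h' => ev_upd _ _ _ h h'
        have ea := hu a ha.1.1.2 ha'.1.1.2
        have eb := hu b ha.1.1.1.2 ha'.1.1.1.2
        have ec := hu c ha.1.1.1.1 ha'.1.1.1.1
        have ed := hu d ha.1.2 ha'.1.2
        have eR : ev (upd ψ q v) (c ++ q :: d) = ev ψ (c ++ b ++ a ++ d) := by
          simp only [ev_append, ev_cons, ec, ed, lv_upd_self]
          simp only [hv, mul_assoc]
        have eD : ev (upd ψ q v) (a ++ ng q :: b) = 1 := by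
          simp only [ev_append, ev_cons, ea, eb, lv_ng, lv_upd_self]
          rw [hv]; group
        refine ⟨upd ψ q v, ?_, ?_⟩
        · intro D' hD' i
          simp only [List.mem_cons, List.mem_append] at hD'
          rcases hD' with rfl | h | rfl | h
          · rw [eR]; exact e6 _ (by simp) i
          · rw [hu D' (ha.2.1 D' h) (ha'.2.1 D' h)]; exact e6 _ (by simp [h]) i
          · rw [eD]; simp
          · rw [hu D' (ha.2.2 D' h) (ha'.2.2 D' h)]; exact e6 _ (by simp [h]) i
        · intro i j
          rw [← e7]
          simp only [List.map_cons, List.map_append, List.sum_cons, List.sum_append, eR, eD,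
            Heis.one_M, zero_add]
          rw [List.map_congr_left (l := U) (fun D h => by rw [hu D (ha.2.1 D h) (ha'.2.1 D h)]),
            List.map_congr_left (l := V) (fun D h => by rw [hu D (ha.2.2 D h) (ha'.2.2 D h)])]
    · push Not at hmerge
      have hqR : Quad R := by
        refine ⟨(List.nodup_append.1 hq.1).1, fun p hp => ?_⟩
        have := hq.2 p (List.mem_append_left _ hp)
        exact (List.mem_append.1 this).resolve_right (hmerge p hp)
      rcases pattern R hR hqR with ⟨c, a, h, rfl⟩ | ⟨c, a, d, b, e, f, h, rfl⟩
      · -- cancellation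
        have hperm : ((c ++ a :: ng a :: h) ++ Ds.flatten).Perm
            (a :: ng a :: ((c ++ h) ++ Ds.flatten)) := by
          classical
          rw [List.perm_iff_count]; intro z
          simp only [List.count_append, List.count_cons]
          omega
        obtain ⟨hq', ha, ha'⟩ := (hq.perm hperm).drop
        simp only [List.length_append, List.length_cons] at hN hL
        obtain ⟨I, n, e1, e2, e3, e4, e5, ψ, e6, e7⟩ := ih (c ++ h) Ds
          (by simp only [List.length_append]; omega)
          (by simp only [List.length_append]; omega) hq'
        have hev : ∀ {Δ : Type} [Group Δ] (φ : X → Δ), ev φ (c ++ a :: ng a :: h) = ev φ (c ++ h) := by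
          intro Δ _ φ; simp
        refine ⟨I, n, by rw [hev]; exact e1, e2, e3, e4, e5, ψ, ?_, ?_⟩
        · intro D hD i
          rcases List.mem_cons.1 hD with rfl | h
          · rw [hev]; exact e6 _ (by simp) i
          · exact e6 D (by simp [h]) i
        · intro i j
          rw [← e7, List.map_cons, hev, List.map_cons]
      · -- handle
        have hperm : ((c ++ a :: (d ++ b :: (e ++ ng a :: (f ++ ng b :: h)))) ++ Ds.flatten).Perm
            (a :: ng a :: b :: ng b :: ((c ++ f ++ e ++ d ++ h) ++ Ds.flatten)) := by
          classical
          rw [List.perm_iff_count]; intro z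
          simp only [List.count_append, List.count_cons]
          omega
        obtain ⟨hq1, ha, ha'⟩ := (hq.perm hperm).drop
        obtain ⟨hq', hb, hb'⟩ := hq1.drop
        simp only [List.length_append, List.length_cons] at hN hL
        obtain ⟨I, n, e1, e2, e3, e4, e5, ψ, e6, e7⟩ := ih (c ++ f ++ e ++ d ++ h) Ds
          (by simp only [List.length_append]; omega)
          (by simp only [List.length_append]; omega) hq'
        set wx : Wd X := c ++ f ++ e ++ [ng a] ++ iw c with hwx
        set wy : Wd X := c ++ f ++ [ng b] ++ iw d ++ iw e ++ iw f ++ iw c with hwy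
        refine ⟨I ++ [Sum.inl (ev θ wy, ev θ wx)], n + 1, ?_, ?_, ?_, ?_, ?_, ?_⟩
        · have hid := handle_id (lv θ a) (lv θ b) (ev θ c) (ev θ d) (ev θ e) (ev θ f) (ev θ h)
            (ev θ f * ev θ e * (lv θ a)⁻¹) (ev θ f * (lv θ b)⁻¹ * (ev θ d)⁻¹ * (ev θ e)⁻¹ * (ev θ f)⁻¹)
            (by group) (by group)
          have e8 : (I.map ival).prod = (ev θ (c ++ f ++ e ++ d ++ h))⁻¹ :=
            eq_inv_of_mul_eq_one_right e1
          rw [List.map_append, List.prod_append, e8]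
          simp only [ev_append, ev_cons, lv_ng, List.map_cons, List.map_nil, List.prod_cons,
            List.prod_nil, ival, hwx, hwy, ev_iw, ev_nil]
          rw [hid]
          group
        · simp [List.filterMap_cons, e2]
        · simpa [List.filterMap_cons] using e3
        · intro x y hxy
          simp only [List.mem_append, List.mem_singleton, Sum.inl.injEq, Prod.mk.injEq] at hxy
          rcases hxy with h' | ⟨rfl, rfl⟩
          · exact e4 x y h'
          · constructor
            · refine (hl wy).trans ?_
              simp only [hwy, List.length_append, iw_length, List.length_cons, List.length_nil]
              omega
            · refine (hl wx).trans ?_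
              simp only [hwx, List.length_append, iw_length, List.length_cons, List.length_nil]
              omega
        · intro d' z h'
          exact e5 d' z (by simpa using h')
        · simp only [List.mem_append, List.mem_cons, not_or,
            List.mem_flatten, not_exists, not_and] at ha ha' hb hb'
          let x0 : Heis (ℕ × Bool) := ⟨fun i => if i = (n, false) then 1 else 0, fun _ _ => 0⟩
          let y0 : Heis (ℕ × Bool) := ⟨fun i => if i = (n, true) then 1 else 0, fun _ _ => 0⟩
          set va := x0⁻¹ * ev ψ f * ev ψ e with hva
          set vb := (ev ψ d)⁻¹ * (ev ψ e)⁻¹ * (ev ψ f)⁻¹ * y0⁻¹ * ev ψ f with hvb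
          have hu : ∀ w', a ∉ w' → ng a ∉ w' → b ∉ w' → ng b ∉ w' →
              ev (upd (upd ψ a va) b vb) w' = ev ψ w' := by
            intro w' h1 h2 h3 h4
            rw [ev_upd _ _ _ h3 h4, ev_upd _ _ _ h1 h2]
          have hla : lv (upd (upd ψ a va) b vb) a = va := by
            rw [lv_upd_of_ne _ _ _ _ ha.1 ha.2.1, lv_upd_self]
          have ec := hu c (by tauto) (by tauto) (by tauto) (by tauto)
          have ed := hu d (by tauto) (by tauto) (by tauto) (by tauto)
          have ee := hu e (by tauto) (by tauto) (by tauto) (by tauto)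
          have ef := hu f (by tauto) (by tauto) (by tauto) (by tauto)
          have eh := hu h (by tauto) (by tauto) (by tauto) (by tauto)
          have eD : ∀ D ∈ Ds, ev (upd (upd ψ a va) b vb) D = ev ψ D := by
            intro D hD
            exact hu D (ha.2.2.2 D hD) (ha'.2.2.2 D hD) (hb.2 D hD) (hb'.2 D hD)
          have eR : ev (upd (upd ψ a va) b vb)
              (c ++ a :: (d ++ b :: (e ++ ng a :: (f ++ ng b :: h)))) =
              ev ψ c * (x0⁻¹ * y0⁻¹ * x0 * y0) * (ev ψ f * (ev ψ e * (ev ψ d * ev ψ h))) := by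
            simp only [ev_append, ev_cons, lv_ng, lv_upd_self, hla, ec, ed, ee, ef, eh]
            exact handle_id _ _ _ _ _ _ _ _ _ rfl rfl
          refine ⟨upd (upd ψ a va) b vb, ?_, ?_⟩
          · intro D hD i
            rcases List.mem_cons.1 hD with rfl | h'
            · rw [eR]
              have := e6 (c ++ f ++ e ++ d ++ h) (by simp) i
              simp only [ev_append, Heis.mul_v, Heis.inv_v] at this ⊢
              linarith
            · rw [eD D h']; exact e6 D (by simp [h']) i
          · intro i j
            simp only [Jf]
            rw [← e7, List.map_cons, List.map_cons, List.sum_cons, List.sum_cons, eR,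
              List.map_congr_left (l := Ds) (fun D h => by rw [eD D h])]
            simp only [ev_append, Heis.mul_v, Heis.inv_v, Heis.mul_M, Heis.inv_M, x0, y0]
            ring

end PhaseC

/-! ### Phase 0 : decomposition of a trivial word into monochromatic blocks -/

section PhaseZero
open Monoid

variable {J : Type} {M : J → Type} [∀ i, Group (M i)]

lemma group_runs (l : List (Σ i, M i))
    (hP : ∀ u i (bs : List (M i)) v, l = u ++ bs.map (Sigma.mk i) ++ v → bs ≠ [] → bs.prod ≠ 1) :
    ∃ L : List (Σ i, M i), (∀ p ∈ L, p.2 ≠ 1) ∧ L.IsChain (fun a b => a.1 ≠ b.1) ∧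
      (L.map (fun s => CoprodI.of s.2)).prod = (l.map (fun s => CoprodI.of s.2)).prod ∧
      (l ≠ [] → ∃ i, ∃ bs : List (M i), ∃ l' L', l = bs.map (Sigma.mk i) ++ l' ∧ bs ≠ [] ∧
        L = ⟨i, bs.prod⟩ :: L') := by
  induction l with
  | nil => exact ⟨[], by simp, by simp, by simp, by simp⟩
  | cons s l ih =>
    have hP' : ∀ u i (bs : List (M i)) v, l = u ++ bs.map (Sigma.mk i) ++ v → bs ≠ [] →
        bs.prod ≠ 1 := by
      intro u i bs v h hb
      exact hP (s :: u) i bs v (by rw [h]; simp) hb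
    have hs : s.2 ≠ 1 := by
      have := hP [] s.1 [s.2] l (by simp) (by simp)
      simpa using this
    obtain ⟨L, h1, h2, h3, h4⟩ := ih hP'
    rcases eq_or_ne l [] with rfl | hl
    · refine ⟨[s], by simpa using hs, by simp, by simp, fun _ => ⟨s.1, [s.2], [], [], by simp⟩⟩
    obtain ⟨i, bs, l', L', rfl, hb, rfl⟩ := h4 hl
    rcases s with ⟨j, a⟩
    by_cases hij : j = i
    · subst hij
      have hne := hP [] j (a :: bs) l' (by simp) (by simp)
      refine ⟨⟨j, (a :: bs).prod⟩ :: L', ?_, ?_, ?_, fun _ => ⟨j, a :: bs, l', L', by simp⟩⟩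
      · intro p hp
        rcases List.mem_cons.1 hp with rfl | hp
        · exact hne
        · exact h1 p (by simp [hp])
      · rw [List.isChain_cons] at h2 ⊢
        exact h2
      · simp only [List.map_cons, List.prod_cons, map_mul] at h3 ⊢
        rw [← h3, mul_assoc]
    · refine ⟨⟨j, a⟩ :: ⟨i, bs.prod⟩ :: L', ?_, ?_, ?_, fun _ => ⟨j, [a], _, ⟨i, bs.prod⟩ :: L', rfl, by simp, by simp⟩⟩
      · intro p hp
        rcases List.mem_cons.1 hp with rfl | hp
        · exact hs
        · exact h1 p hp
      · rw [List.isChain_cons]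
        refine ⟨?_, h2⟩
        intro y hy
        simp at hy
        subst hy
        exact hij
      · rw [List.map_cons, List.prod_cons, h3, List.map_cons, List.prod_cons]

lemma mono_subword (l : List (Σ i, M i)) (hne : l ≠ [])
    (h1 : (l.map (fun s => CoprodI.of s.2)).prod = 1) :
    ∃ u i, ∃ bs : List (M i), ∃ v, l = u ++ bs.map (Sigma.mk i) ++ v ∧ bs ≠ [] ∧ bs.prod = 1 := by
  classical
  by_contra hcon
  push Not at hcon
  obtain ⟨L, a1, a2, a3, a4⟩ := group_runs l hcon
  obtain ⟨i, bs, l', L', -, -, hL⟩ := a4 hne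
  let w : CoprodI.Word M := ⟨L, a1, a2⟩
  have hw : w.prod = 1 := by
    show (L.map (fun s => CoprodI.of s.2)).prod = 1
    rw [a3, h1]
  have : w = CoprodI.Word.empty := by
    apply CoprodI.Word.equiv.symm.injective
    show w.prod = CoprodI.Word.prod CoprodI.Word.empty
    rw [hw, CoprodI.Word.prod_empty]
  have h2 : L = [] := congrArg CoprodI.Word.toList this
  rw [hL] at h2
  simp at h2

variable {X Γ : Type} [Group Γ]

theorem phaseZero (θ : X → Γ) (typ : X → J) (a : ∀ x, M (typ x)) (φ : Γ →* CoprodI M)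
    (io : ∀ i, M i →* Γ) (h1 : ∀ x, φ (θ x) = CoprodI.of (a x)) (h2 : ∀ x, io (typ x) (a x) = θ x) :
    ∀ (n : ℕ) (E : Wd X), E.length ≤ n → ev θ E = 1 →
      ∃ Bs : List (Wd X), Bs.flatten.Perm E ∧ (∀ B ∈ Bs, Good θ typ B) ∧
        ∀ (Δ : Type) [Group Δ] (f : X → Δ), (∀ B ∈ Bs, ev f B = 1) → ev f E = 1 := by
  intro n
  induction n with
  | zero =>
    intro E hE _
    rw [List.eq_nil_of_length_eq_zero (Nat.le_zero.1 hE)]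
    exact ⟨[], by simp, by simp, by simp⟩
  | succ n ih =>
    intro E hE hev
    rcases eq_or_ne E [] with rfl | hne
    · exact ⟨[], by simp, by simp, by simp⟩
    let sg : X × Bool → Σ i, M i := fun p => ⟨typ p.1, if p.2 then a p.1 else (a p.1)⁻¹⟩
    have e1 : ∀ p, φ (lv θ p) = CoprodI.of (sg p).2 := by
      rintro ⟨x, b⟩
      cases b <;> simp [lv, sg, h1]
    have e2 : ∀ p, lv θ p = io (sg p).1 (sg p).2 := by
      rintro ⟨x, b⟩
      cases b <;> simp [lv, sg, h2]
    have e3 : ((E.map sg).map (fun s => CoprodI.of s.2)).prod = 1 := by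
      rw [List.map_map, ← map_one φ, ← hev, ev, map_list_prod, List.map_map]
      congr 1
      apply List.map_congr_left
      intro p _
      exact (e1 p).symm
    obtain ⟨u, i, bs, v, hl, hb, hp⟩ := mono_subword (E.map sg) (by simpa using hne) e3
    rw [List.map_eq_append_iff] at hl
    obtain ⟨E1, V, rfl, hl, hV⟩ := hl
    rw [List.map_eq_append_iff] at hl
    obtain ⟨U, B, rfl, hU, hB⟩ := hl
    have hlen : B.length = bs.length := by simpa using congrArg List.length hB
    have hBn : B.length ≠ 0 := by rw [hlen]; simpa using hb
    have gB : Good θ typ B := by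
      have ht : ∀ p ∈ B, typ p.1 = i := by
        intro p hpB
        have : sg p ∈ bs.map (Sigma.mk i) := by rw [← hB]; exact List.mem_map_of_mem hpB
        obtain ⟨b, _, hb⟩ := List.mem_map.1 this
        exact (congrArg Sigma.fst hb).symm
      refine ⟨fun p hp q hq => (ht p hp).trans (ht q hq).symm, ?_⟩
      have : B.map (lv θ) = bs.map (io i) := by
        have := congrArg (List.map (fun s : Σ i, M i => io s.1 s.2)) hB
        rw [List.map_map, List.map_map] at this
        rw [List.map_congr_left (fun p _ => e2 p)]
        exact this
      rw [ev, this, ← map_list_prod, hp, map_one]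
    have hUV : ev θ (U ++ V) = 1 := by
      simpa [gB.2] using hev
    obtain ⟨Bs, b1, b2, b3⟩ := ih (U ++ V) (by simp only [List.length_append] at hE ⊢; omega) hUV
    refine ⟨B :: Bs, ?_, ?_, ?_⟩
    · rw [List.flatten_cons]
      refine (List.Perm.append_left B b1).trans ?_
      rw [List.append_assoc]
      classical
      rw [List.perm_iff_count]; intro z
      simp only [List.count_append]; omega
    · intro B' hB'
      rcases List.mem_cons.1 hB' with rfl | h
      · exact gB
      · exact b2 _ h
    · intro Δ _ f hf
      have c1 := hf B (by simp)
      have c2 := b3 Δ f (fun B' h => hf B' (by simp [h]))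
      simpa [c1] using c2

end PhaseZero

/-! ### Sorting the items -/

section Sorting
variable {Γ : Type} [Group Γ]

/-- conjugating an item -/
def cj : Item Γ → Γ → Item Γ
  | Sum.inl (x, y), h => Sum.inl (h⁻¹ * x * h, h⁻¹ * y * h)
  | Sum.inr (d, z), h => Sum.inr (d, z * h)

lemma ival_cj (i : Item Γ) (h : Γ) : ival (cj i h) = h⁻¹ * ival i * h := by
  rcases i with ⟨x, y⟩ | ⟨d, z⟩ <;> simp only [cj, ival] <;> group

/-- inverting an item -/
def vi : Item Γ → Item Γ
  | Sum.inl (x, y) => Sum.inl (y, x)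
  | Sum.inr (d, z) => Sum.inr (d⁻¹, z)

lemma ival_vi (i : Item Γ) : ival (vi i) = (ival i)⁻¹ := by
  rcases i with ⟨x, y⟩ | ⟨d, z⟩ <;> simp only [vi, ival] <;> group

lemma prod_vi (I : List (Item Γ)) : ((I.reverse.map vi).map ival).prod = ((I.map ival).prod)⁻¹ := by
  rw [List.prod_inv_reverse, List.map_map, List.map_map, ← List.map_reverse]
  congr 2
  funext i
  exact ival_vi i

lemma prod_len (ℓ : Γ → ℕ) (h1 : ℓ 1 = 0) (hm : ∀ a b, ℓ (a * b) ≤ ℓ a + ℓ b) (l : List Γ) :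
    ℓ l.prod ≤ (l.map ℓ).sum := by
  induction l with
  | nil => simp [h1]
  | cons a l ih =>
    have := hm a l.prod
    simp only [List.prod_cons, List.map_cons, List.sum_cons]; omega

lemma sorting (ℓ : Γ → ℕ) (h1 : ℓ 1 = 0) (hm : ∀ a b, ℓ (a * b) ≤ ℓ a + ℓ b)
    (hi : ∀ a, ℓ a⁻¹ = ℓ a) (T : ℕ) (I2 : List (Item Γ)) :
    ∀ I1 : List (Item Γ), I1.Perm I2 → (I1.map (fun i => ℓ (ival i))).sum ≤ T →
      ∃ I3, List.Forall₂ (fun i i' => ∃ h, ℓ h ≤ T ∧ i' = cj i h) I2 I3 ∧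
        (I3.map ival).prod = (I1.map ival).prod := by
  induction I2 with
  | nil =>
    intro I1 hp _
    rw [hp.eq_nil]
    exact ⟨[], List.Forall₂.nil, rfl⟩
  | cons a I2 ih =>
    intro I1 hp hT
    obtain ⟨u, v, rfl⟩ := List.append_of_mem (hp.mem_iff.2 (by simp : a ∈ a :: I2))
    have hp' : (u ++ v).Perm I2 := (List.perm_middle.symm.trans hp).cons_inv
    simp only [List.map_append, List.map_cons, List.sum_append, List.sum_cons] at hT
    obtain ⟨I3, h3, h4⟩ := ih (u ++ v) hp'
      (by simp only [List.map_append, List.sum_append]; omega)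
    refine ⟨cj a ((u.map ival).prod)⁻¹ :: I3, List.Forall₂.cons ⟨_, ?_, rfl⟩ h3, ?_⟩
    · rw [hi]
      refine (prod_len ℓ h1 hm _).trans ?_
      rw [List.map_map]
      show (u.map (fun i => ℓ (ival i))).sum ≤ T
      omega
    · rw [List.map_cons, List.prod_cons, h4, ival_cj]
      simp only [List.map_append, List.prod_append, List.map_cons, List.prod_cons]
      group

lemma perm_split (I : List (Item Γ)) :
    I.Perm ((I.filterMap Sum.getLeft?).map Sum.inl ++ (I.filterMap Sum.getRight?).map Sum.inr) := by
  induction I with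
  | nil => simp
  | cons i I ih =>
    rcases i with i | i
    · simpa [List.filterMap_cons] using ih
    · simp only [List.filterMap_cons, Sum.getLeft?_inr, Sum.getRight?_inr, List.map_cons]
      exact (List.Perm.cons _ ih).trans List.perm_middle.symm

lemma perm_lift {α β : Type} (f : α → β) (t : List β) :
    ∀ l : List α, (l.map f).Perm t → ∃ l' : List α, l'.Perm l ∧ l'.map f = t := by
  induction t with
  | nil => intro l h; exact ⟨[], by simpa using h.eq_nil.symm, rfl⟩
  | cons b t ih =>
    intro l h
    obtain ⟨a, ha, rfl⟩ := List.mem_map.1 (h.mem_iff.2 (by simp : b ∈ b :: t))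
    obtain ⟨u, v, rfl⟩ := List.append_of_mem ha
    have : ((u ++ v).map f).Perm t := by
      rw [List.map_append]
      rw [List.map_append, List.map_cons] at h
      exact (List.perm_middle.symm.trans h).cons_inv
    obtain ⟨l', h1, h2⟩ := ih _ this
    exact ⟨a :: l', (List.Perm.cons a h1).trans List.perm_middle.symm, by simp [h2]⟩

theorem finish (ℓ : Γ → ℕ) (h1 : ℓ 1 = 0) (hm : ∀ a b, ℓ (a * b) ≤ ℓ a + ℓ b)
    (hi : ∀ a, ℓ a⁻¹ = ℓ a) (g m K : ℕ) (C : Fin m → Γ) (Cl : Γ) (I : List (Item Γ))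
    (e1 : (I.map ival).prod * Cl = 1) (e2 : (I.filterMap Sum.getLeft?).length ≤ g)
    (e3 : ((I.filterMap Sum.getRight?).map Prod.fst).Perm (List.ofFn C))
    (e4 : ∀ x y, Sum.inl (x, y) ∈ I → ℓ x ≤ K ∧ ℓ y ≤ K)
    (e5 : ∀ d z, Sum.inr (d, z) ∈ I → ℓ z ≤ K) (T : ℕ)
    (hT : T = g * (4 * K) + (m * (2 * K) + ∑ j, ℓ (C j))) :
    ∃ (x y : Fin g → Γ) (z : Fin m → Γ),
      (List.ofFn fun i => (x i)⁻¹ * (y i)⁻¹ * x i * y i).prod *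
          (List.ofFn fun j => (z j)⁻¹ * C j * z j).prod * Cl = 1 ∧
      (∀ i, ℓ (x i) ≤ K + 2 * T) ∧ (∀ i, ℓ (y i) ≤ K + 2 * T) ∧ ∀ j, ℓ (z j) ≤ K + 2 * T := by
  obtain ⟨rs, hr1, hr2⟩ := perm_lift Prod.fst _ _ e3
  set ls := I.filterMap Sum.getLeft? with hls
  have hp : I.Perm (ls.map Sum.inl ++ rs.map Sum.inr) :=
    (perm_split I).trans (List.Perm.append_left _ (hr1.symm.map _))
  have bl : ∀ p ∈ ls, ℓ p.1 ≤ K ∧ ℓ p.2 ≤ K := by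
    intro p hp'
    exact e4 p.1 p.2 (hp.mem_iff.2 (by simp [hp']))
  have br : ∀ p ∈ rs, ℓ p.2 ≤ K := by
    intro p hp'
    exact e5 p.1 p.2 (hp.mem_iff.2 (by simp [hp']))
  have hrl : rs.length = m := by simpa using congrArg List.length hr2
  have hsum : (I.map (fun i => ℓ (ival i))).sum ≤ T := by
    rw [(hp.map _).sum_eq, List.map_append, List.sum_append, hT]
    apply add_le_add
    · rw [List.map_map]
      refine (List.sum_le_card_nsmul _ (4 * K) ?_).trans ?_
      · intro n hn
        obtain ⟨p, hp', rfl⟩ := List.mem_map.1 hn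
        obtain ⟨b1, b2⟩ := bl p hp'
        show ℓ (p.1⁻¹ * p.2⁻¹ * p.1 * p.2) ≤ _
        have := hm (p.1⁻¹ * p.2⁻¹ * p.1) p.2
        have := hm (p.1⁻¹ * p.2⁻¹) p.1
        have := hm (p.1⁻¹) p.2⁻¹
        rw [hi, hi] at this
        omega
      · simp only [List.length_map, smul_eq_mul]
        exact Nat.mul_le_mul_right _ e2
    · have h6 : ∑ j, ℓ (C j) = (rs.map (fun p => ℓ p.1)).sum := by
        have : rs.map (fun p => ℓ p.1) = (rs.map Prod.fst).map ℓ := by simp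
        rw [this, hr2, List.map_ofFn, List.sum_ofFn]; rfl
      rw [h6, ← hrl, List.map_map]
      clear hr1 hr2 hp h6 hrl hT
      induction rs with
      | nil => simp
      | cons p rs ih =>
        have := ih (fun q hq => br q (by simp [hq]))
        have b1 := br p (by simp)
        have h7 : ℓ (p.2⁻¹ * p.1 * p.2) ≤ 2 * K + ℓ p.1 := by
          have := hm (p.2⁻¹ * p.1) p.2
          have := hm (p.2⁻¹) p.1
          rw [hi] at this
          omega
        simp only [List.map_cons, List.sum_cons, List.length_cons, Function.comp, ival] at this ⊢
        rw [add_mul]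
        omega
  obtain ⟨I3, h3, h4⟩ := sorting ℓ h1 hm hi T _ I hp hsum
  have hA : ∀ (ls : List (Γ × Γ)), (∀ p ∈ ls, ℓ p.1 ≤ K ∧ ℓ p.2 ≤ K) → ∀ (J I3 : List (Item Γ)),
      List.Forall₂ (fun i i' => ∃ h, ℓ h ≤ T ∧ i' = cj i h) (ls.map Sum.inl ++ J) I3 →
      ∃ (P : List (Γ × Γ)) (J' : List (Item Γ)), I3 = P.map Sum.inl ++ J' ∧ P.length = ls.length ∧
        (∀ p ∈ P, ℓ p.1 ≤ K + 2 * T ∧ ℓ p.2 ≤ K + 2 * T) ∧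
        List.Forall₂ (fun i i' => ∃ h, ℓ h ≤ T ∧ i' = cj i h) J J' := by
    intro ls
    induction ls with
    | nil => intro _ J I3 h; exact ⟨[], I3, rfl, rfl, by simp, by simpa using h⟩
    | cons p ls ih =>
      intro hb J I3 h
      simp only [List.map_cons, List.cons_append] at h
      rcases h with _ | ⟨⟨h, hT', rfl⟩, hrest⟩
      obtain ⟨P, J', rfl, c1, c2, c3⟩ := ih (fun q hq => hb q (by simp [hq])) _ _ hrest
      refine ⟨(h⁻¹ * p.1 * h, h⁻¹ * p.2 * h) :: P, J', rfl, by simp [c1], ?_, c3⟩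
      intro q hq
      rcases List.mem_cons.1 hq with rfl | hq
      · obtain ⟨b1, b2⟩ := hb p (by simp)
        have key : ∀ a, ℓ a ≤ K → ℓ (h⁻¹ * a * h) ≤ K + 2 * T := by
          intro a ha
          have := hm (h⁻¹ * a) h
          have := hm (h⁻¹) a
          rw [hi] at this
          omega
        exact ⟨key _ b1, key _ b2⟩
      · exact c2 q hq
  have hB : ∀ (rs : List (Γ × Γ)), (∀ p ∈ rs, ℓ p.2 ≤ K) → ∀ (I3 : List (Item Γ)),
      List.Forall₂ (fun i i' => ∃ h, ℓ h ≤ T ∧ i' = cj i h) (rs.map Sum.inr) I3 →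
      ∃ (P : List (Γ × Γ)), I3 = P.map Sum.inr ∧ P.map Prod.fst = rs.map Prod.fst ∧
        (∀ p ∈ P, ℓ p.2 ≤ K + 2 * T) := by
    intro rs
    induction rs with
    | nil => 
      intro _ I3 h
      simp only [List.map_nil, List.forall₂_nil_left_iff] at h
      exact ⟨[], h, rfl, by simp⟩
    | cons p rs ih =>
      intro hb I3 h
      simp only [List.map_cons] at h
      rcases h with _ | ⟨⟨h, hT', rfl⟩, hrest⟩
      obtain ⟨P, rfl, c1, c2⟩ := ih (fun q hq => hb q (by simp [hq])) _ hrest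
      refine ⟨(p.1, p.2 * h) :: P, rfl, by simp [c1], ?_⟩
      intro q hq
      rcases List.mem_cons.1 hq with rfl | hq
      · have b1 := hb p (by simp)
        have := hm p.2 h
        show ℓ (p.2 * h) ≤ _
        omega
      · exact c2 q hq
  obtain ⟨P, J', rfl, c1, c2, c3⟩ := hA ls bl _ _ h3
  obtain ⟨Q, rfl, d1, d2⟩ := hB rs br _ c3
  rw [hr2] at d1
  have hQ : Q.length = m := by simpa using congrArg List.length d1
  obtain ⟨P', hP', hP'b, hP'v⟩ : ∃ P' : List (Γ × Γ), P'.length = g ∧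
      (∀ p ∈ P', ℓ p.1 ≤ K + 2 * T ∧ ℓ p.2 ≤ K + 2 * T) ∧
      (P'.map (fun p => p.1⁻¹ * p.2⁻¹ * p.1 * p.2)).prod =
        (P.map (fun p => p.1⁻¹ * p.2⁻¹ * p.1 * p.2)).prod := by
    refine ⟨P ++ List.replicate (g - P.length) (1, 1), ?_, ?_, ?_⟩
    · simp; omega
    · intro p hp'
      rcases List.mem_append.1 hp' with h | h
      · exact c2 p h
      · rw [List.eq_of_mem_replicate h]; simp [h1]
    · simp
  subst hP' hQ
  refine ⟨fun i => P'[i].1, fun i => P'[i].2, fun j => Q[j].2, ?_, fun i => (hP'b _ (by simp)).1,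
    fun i => (hP'b _ (by simp)).2, fun j => d2 _ (by simp)⟩
  have f1 : (List.ofFn fun i : Fin P'.length => (P'[i].1)⁻¹ * (P'[i].2)⁻¹ * P'[i].1 * P'[i].2) =
      P'.map (fun p => p.1⁻¹ * p.2⁻¹ * p.1 * p.2) := by
    apply List.ext_getElem <;> simp
  have f2 : (List.ofFn fun j : Fin Q.length => (Q[j].2)⁻¹ * C j * Q[j].2) =
      Q.map (fun p => p.2⁻¹ * p.1 * p.2) := by
    apply List.ext_getElem
    · simp
    · intro i h1 h2
      have hC : C ⟨i, by simpa using h1⟩ = (Q[i]'(by simpa using h1)).1 := by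
        have : (List.ofFn C)[i]'(by simpa using h1) = (Q.map Prod.fst)[i]'(by simpa using h1) := by
          simp only [d1]
        simpa using this
      simp [hC]
  rw [f1, f2, hP'v]
  have f3 : (P.map (fun p => p.1⁻¹ * p.2⁻¹ * p.1 * p.2)).prod *
      (Q.map (fun p => p.2⁻¹ * p.1 * p.2)).prod = (I.map ival).prod := by
    rw [← h4, List.map_append, List.prod_append, List.map_map, List.map_map]
    rfl
  rw [f3, e1]

end Sorting

lemma Heis.comm_M {ι : Type} (a b : Heis ι) (i j : ι) :
    (a⁻¹ * b⁻¹ * a * b).M i j = a.v i * b.v j - b.v i * a.v j := by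
  simp only [Heis.mul_M, Heis.inv_M, Heis.mul_v, Heis.inv_v]; ring

lemma Heis.conj_M {ι : Type} (a c : Heis ι) (h : ∀ i, c.v i = 0) (i j : ι) :
    (a⁻¹ * c * a).M i j = c.M i j := by
  simp only [Heis.mul_M, Heis.inv_M, Heis.mul_v, Heis.inv_v, h]; ring

/-! ### Expanding variables into letters -/

section Expand
variable {S : Type} (n : S → ℕ)

/-- the block of letters of a variable -/
def Wb (s : S) : Wd (Σ s, Fin (n s)) := (List.finRange (n s)).map (fun t => (⟨s, t⟩, true))

/-- substitution of blocks for variables -/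
def sb : Wd S → Wd (Σ s, Fin (n s))
  | [] => []
  | p :: u => (if p.2 then Wb n p.1 else iw (Wb n p.1)) ++ sb u

@[simp] lemma sb_append (u v : Wd S) : sb n (u ++ v) = sb n u ++ sb n v := by
  induction u with
  | nil => rfl
  | cons p u ih => simp [sb, ih]

lemma sb_flatten (L : List (Wd S)) : sb n L.flatten = (L.map (sb n)).flatten := by
  induction L with
  | nil => rfl
  | cons p u ih => simp [ih]

lemma ev_sb {Δ : Type} [Group Δ] (f : (Σ s, Fin (n s)) → Δ) (u : Wd S) :
    ev f (sb n u) = ev (fun s => ev f (Wb n s)) u := by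
  induction u with
  | nil => rfl
  | cons p u ih =>
    rcases p with ⟨s, b⟩
    cases b <;> simp [sb, ih, lv]

lemma mem_Wb (s : S) (q) : q ∈ Wb n s ↔ q.1.1 = s ∧ q.2 = true := by
  rcases q with ⟨⟨s', t⟩, b⟩
  simp only [Wb, List.mem_map, List.mem_finRange, true_and, Prod.mk.injEq]
  constructor
  · rintro ⟨t', h, rfl⟩
    exact ⟨(congrArg Sigma.fst h).symm, rfl⟩
  · rintro ⟨h, rfl⟩
    subst h
    exact ⟨t, rfl, rfl⟩

lemma mem_sb (u : Wd S) (q) : q ∈ sb n u ↔ (q.1.1, q.2) ∈ u := by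
  induction u with
  | nil => simp [sb]
  | cons p u ih =>
    rcases p with ⟨s, b⟩
    rcases q with ⟨x, c⟩
    cases b <;> cases c <;> simp [sb, ih, mem_Wb, ng]

lemma nodup_Wb (s : S) : (Wb n s).Nodup := by
  unfold Wb
  refine (List.nodup_finRange _).map ?_
  intro a b h
  simpa using h

lemma nodup_iw {X : Type} {w : Wd X} (h : w.Nodup) : (iw w).Nodup := by
  unfold iw
  rw [List.nodup_reverse]
  exact h.map (fun a b hab => by rw [← ng_ng a, hab, ng_ng])

lemma quad_sb (T : Wd S) (h : Quad T) : Quad (sb n T) := by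
  constructor
  · have := h.1
    clear h
    induction T with
    | nil => simp [sb]
    | cons p T ih =>
      rw [List.nodup_cons] at this
      simp only [sb]
      rw [List.nodup_append']
      refine ⟨?_, ih this.2, ?_⟩
      · split_ifs
        · exact nodup_Wb n _
        · exact nodup_iw (nodup_Wb n _)
      · intro q hq hq'
        rw [mem_sb] at hq'
        apply this.1
        have : p = (q.1.1, q.2) := by
          have : q ∈ sb n [p] := by simpa [sb] using hq
          rw [mem_sb] at this
          exact (List.mem_singleton.1 this).symm
        rw [this]; exact hq'
  · intro q hq
    rw [mem_sb] at hq ⊢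
    exact h.2 _ hq

lemma ev_flatten {X Δ : Type} [Group Δ] (f : X → Δ) (L : List (Wd X)) :
    ev f L.flatten = (L.map (ev f)).prod := by
  induction L with
  | nil => rfl
  | cons w L ih => simp [ih]

end Expand

section EqWord
variable (g m : ℕ)

/-- names of the variables and coefficients -/
abbrev Nm (g m : ℕ) := (Fin g ⊕ Fin g) ⊕ (Fin m ⊕ Fin m) ⊕ Unit

/-- x-variables -/
abbrev nx {g m : ℕ} (i : Fin g) : Nm g m := Sum.inl (Sum.inl i)
/-- y-variables -/
abbrev ny {g m : ℕ} (i : Fin g) : Nm g m := Sum.inl (Sum.inr i)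
/-- z-variables -/
abbrev nz {g m : ℕ} (i : Fin m) : Nm g m := Sum.inr (Sum.inl (Sum.inl i))
/-- coefficients -/
abbrev nc {g m : ℕ} (i : Fin m) : Nm g m := Sum.inr (Sum.inl (Sum.inr i))
/-- last coefficient -/
abbrev nl {g m : ℕ} : Nm g m := Sum.inr (Sum.inr ())

/-- the equation word -/
def eqw : Wd (Nm g m) :=
  (List.ofFn fun i : Fin g => [(nx i, false), (ny i, false), (nx i, true), (ny i, true)]).flatten ++
  (List.ofFn fun j : Fin m => [(nz j, false), (nc j, true), (nz j, true)]).flatten ++ [(nl, true)]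

/-- the coefficient words -/
def cfw : List (Wd (Nm g m)) := [(nl, false)] :: List.ofFn fun j : Fin m => [(nc j, false)]

lemma ev_eqw {Δ : Type} [Group Δ] (F : Nm g m → Δ) : ev F (eqw g m) =
    (List.ofFn fun i => (F (nx i))⁻¹ * (F (ny i))⁻¹ * F (nx i) * F (ny i)).prod *
    (List.ofFn fun j => (F (nz j))⁻¹ * F (nc j) * F (nz j)).prod * F nl := by
  simp only [eqw, ev_append, ev_flatten, List.map_ofFn]
  congr 1
  · congr 1
    · congr 2; funext i; simp [lv, mul_assoc]
    · congr 2; funext i; simp [lv, mul_assoc]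
  · simp [lv]

lemma quad_eqw : Quad (eqw g m ++ (cfw g m).flatten) := by
  have hmem : ∀ p, p ∈ eqw g m ++ (cfw g m).flatten := by
    rintro ⟨((i | i) | (i | i) | ⟨⟩), b⟩ <;> cases b <;> simp [eqw, cfw, List.mem_ofFn]
  refine ⟨?_, fun p _ => hmem _⟩
  have h1 : (eqw g m ++ (cfw g m).flatten).length = Fintype.card (Nm g m × Bool) := by
    simp [eqw, cfw, List.length_flatten, List.map_ofFn, List.sum_ofFn, Function.comp_def]
    ring
  classical
  rw [← Multiset.coe_nodup, ← Multiset.toFinset_card_eq_card_iff_nodup]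
  rw [Multiset.coe_card, h1]
  have : (↑(eqw g m ++ (cfw g m).flatten) : Multiset (Nm g m × Bool)).toFinset = Finset.univ := by
    ext p; simp only [Multiset.mem_toFinset, Multiset.mem_coe, Finset.mem_univ, iff_true]; exact hmem p
  rw [this]; rfl

end EqWord

section Core
open Monoid

theorem core {Γ J Bt : Type} [Group Γ] {M : J → Type} [∀ i, Group (M i)] (Gen : Bt → Γ)
    (tB : Bt → J) (aB : ∀ b, M (tB b)) (φ : Γ →* CoprodI M) (io : ∀ i, M i →* Γ)
    (p1 : ∀ b, φ (Gen b) = CoprodI.of (aB b)) (p2 : ∀ b, io (tB b) (aB b) = Gen b)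
    (hcM : ∀ i (a b : M i), Commute a b)
    (ℓ : Γ → ℕ) (h1 : ℓ 1 = 0) (hm : ∀ a b, ℓ (a * b) ≤ ℓ a + ℓ b)
    (hi : ∀ a, ℓ a⁻¹ = ℓ a) (hG : ∀ b, ℓ (Gen b) ≤ 1)
    (hw : ∀ x, ∃ w : Wd Bt, ev Gen w = x ∧ w.length = ℓ x)
    (g m : ℕ) (C : Fin m → Γ) (Cl : Γ) (x y : Fin g → Γ) (z : Fin m → Γ)
    (heq : (List.ofFn fun i => (x i)⁻¹ * (y i)⁻¹ * x i * y i).prod *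
          (List.ofFn fun j => (z j)⁻¹ * C j * z j).prod * Cl = 1) (K : ℕ)
    (hK : K = 4 * (∑ j, ℓ (C j) + ℓ Cl)) :
    ∃ I : List (Item Γ), (I.map ival).prod * Cl = 1 ∧ (I.filterMap Sum.getLeft?).length ≤ g ∧
    ((I.filterMap Sum.getRight?).map Prod.fst).Perm (List.ofFn C) ∧
    (∀ x y, Sum.inl (x, y) ∈ I → ℓ x ≤ K ∧ ℓ y ≤ K) ∧
    (∀ d z, Sum.inr (d, z) ∈ I → ℓ z ≤ K) := by
  choose wd hwd hwl using hw
  let vS : Nm g m → Γ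
    | Sum.inl (Sum.inl i) => x i
    | Sum.inl (Sum.inr i) => y i
    | Sum.inr (Sum.inl (Sum.inl i)) => z i
    | Sum.inr (Sum.inl (Sum.inr i)) => C i
    | Sum.inr (Sum.inr ()) => Cl
  let n : Nm g m → ℕ := fun s => (wd (vS s)).length
  let lt : (Σ s, Fin (n s)) → Bt × Bool := fun p => (wd (vS p.1)).get p.2
  let θ : (Σ s, Fin (n s)) → Γ := fun p => lv Gen (lt p)
  let typ : (Σ s, Fin (n s)) → J := fun p => tB (lt p).1
  let a : ∀ p, M (typ p) := fun p => if (lt p).2 then aB (lt p).1 else (aB (lt p).1)⁻¹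
  have q1 : ∀ p, φ (θ p) = CoprodI.of (a p) := by
    intro p
    simp only [θ, a, lv]
    split_ifs <;> simp [p1, typ]
  have q2 : ∀ p, io (typ p) (a p) = θ p := by
    intro p
    simp only [θ, a, lv]
    split_ifs <;> simp [p2, typ]
  have hc : ∀ p q, typ p = typ q → Commute (θ p) (θ q) := by
    intro p q h
    rw [← q2 p, ← q2 q]
    have : ∀ (i j : J) (a : M i) (b : M j), i = j → Commute (io i a) (io j b) := by
      rintro i j a b rfl
      exact (hcM i a b).map (io i)
    exact this _ _ _ _ h
  have hθ : ∀ p, ℓ (θ p) ≤ 1 := by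
    intro p
    simp only [θ, lv]
    split_ifs
    · exact hG _
    · rw [hi]; exact hG _
  have hWb : ∀ s, ev θ (Wb n s) = vS s := by
    intro s
    rw [← hwd (vS s)]
    simp only [ev, Wb, List.map_map]
    congr 1
    apply List.ext_getElem
    · simp [n]
    · intro i h h'
      simp [lv, θ, lt]
  set E := sb n (eqw g m) with hE
  set Ds := (cfw g m).map (sb n) with hDs
  have hEv : ∀ (Δ : Type) [Group Δ] (f : (Σ s, Fin (n s)) → Δ), ev f E =
      ev (fun s => ev f (Wb n s)) (eqw g m) := fun Δ _ f => ev_sb n f _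
  have hDsv : ∀ (Δ : Type) [Group Δ] (f : (Σ s, Fin (n s)) → Δ), Ds.map (ev f) =
      (ev f (Wb n nl))⁻¹ :: List.ofFn fun j => (ev f (Wb n (nc j)))⁻¹ := by
    intro Δ _ f
    simp only [hDs, cfw, List.map_map, List.map_cons, List.map_ofFn]
    congr 1
    · simp [ev_sb, lv]
    · congr 1
      funext j
      simp [ev_sb, lv]
  have hDl : Ds.flatten.length = ∑ j, ℓ (C j) + ℓ Cl := by
    simp only [hDs, cfw, List.map_cons, List.map_ofFn, List.length_flatten, List.sum_cons, 
      List.sum_ofFn]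
    rw [add_comm]
    congr 1
    · apply Finset.sum_congr rfl
      intro j _
      simp [sb, Wb, n, vS, hwl]
    · simp [sb, Wb, n, vS, hwl]
  have hQ : Quad (E ++ Ds.flatten) := by
    rw [hE, hDs, ← sb_flatten, ← sb_append]
    exact quad_sb n _ (quad_eqw g m)
  have hE1 : ev θ E = 1 := by
    rw [hEv, ev_eqw]
    simp only [hWb]
    exact heq
  obtain ⟨Bs, z1, z2, z3⟩ := phaseZero θ typ a φ io q1 q2 _ E le_rfl hE1
  obtain ⟨Bs', a1, a2, a3, a4⟩ := phaseA θ typ hc Ds _ Bs le_rfl z2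
    (hQ.perm (List.Perm.append_right _ z1.symm))
  obtain ⟨Ds', b1, b2, b3, b4⟩ := phaseB θ Bs' Ds (fun B hB => (a1 B hB).2) a2 a3
  have hlen : Bs'.flatten.length ≤ Ds.flatten.length := by
    have hnd : (Bs'.flatten.map ng).Nodup :=
      (List.nodup_append.1 a2.1).1.map (fun a b hab => by rw [← ng_ng a, hab, ng_ng])
    have hsub : Bs'.flatten.map ng ⊆ Ds.flatten := by
      intro q hq
      obtain ⟨p, hp, rfl⟩ := List.mem_map.1 hq
      exact a3 p hp
    have h9 := (hnd.subperm hsub).length_le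
    rwa [List.length_map] at h9
  have hDv : Ds'.map (ev θ) = Cl⁻¹ :: List.ofFn fun j => (C j)⁻¹ := by
    rw [b2, hDsv]; simp only [hWb]; rfl
  rcases Ds' with _ | ⟨R, Ds'⟩
  · simp at hDv
  rw [List.map_cons, List.cons.injEq] at hDv
  obtain ⟨I, k, c1, c2, c3, c4, c5, ψ, c6, c7⟩ := phaseC θ ℓ h1 hm hi hθ
    (2 * (∑ j, ℓ (C j) + ℓ Cl)) _ R Ds' le_rfl
    (by simp only [List.flatten_cons, List.length_append] at b3; omega) (by simpa using b1)
  have hkg : k ≤ g := by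
    obtain ⟨f1, d1, d2⟩ := b4 _ ψ
    obtain ⟨f2, d3, d4⟩ := a4 _ f1 d1
    have d5 := z3 _ f2 d3
    have d6 : Ds.map (ev f2) = (R :: Ds').map (ev ψ) := by
      rw [← d2]; exact List.map_congr_left d4
    rw [hDsv] at d6
    rw [hEv, ev_eqw] at d5
    set F : Nm g m → Heis (ℕ × Bool) := fun s => ev f2 (Wb n s) with hF
    change _ * F nl = 1 at d5
    have hv : ∀ H ∈ (F nl)⁻¹ :: List.ofFn (fun j => (F (nc j))⁻¹), ∀ i, H.v i = 0 := by
      intro H hH i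
      rw [hF] at hH
      rw [d6] at hH
      obtain ⟨D, hD, rfl⟩ := List.mem_map.1 hH
      exact c6 D hD i
    have hvl : ∀ i, (F nl).v i = 0 := by
      intro i
      have := hv (F nl)⁻¹ (by simp) i
      simpa using this
    have hvc : ∀ j i, (F (nc j)).v i = 0 := by
      intro j i
      have := hv (F (nc j))⁻¹ (by simp [List.mem_ofFn]) i
      simpa using this
    have hsum : ∀ i j, ((F nl)⁻¹).M i j + ∑ t, ((F (nc t))⁻¹).M i j = Jf k i j := by
      intro i j
      rw [← c7 i j]
      have := congrArg (fun l => (l.map (fun H : Heis (ℕ × Bool) => H.M i j)).sum) d6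
      simp only [List.map_cons, List.map_ofFn, List.sum_cons, List.sum_ofFn, List.map_map] at this
      exact this
    apply rank_bound k g (fun t => (F (nx t)).v) (fun t => (F (ny t)).v)
    intro i j
    rw [← hsum]
    have l1 := Heis.list_prod (List.ofFn fun t => (F (nx t))⁻¹ * (F (ny t))⁻¹ * F (nx t) * F (ny t))
      (by
        intro H hH i
        obtain ⟨t, rfl⟩ := (List.mem_ofFn' _ _).1 hH
        simp) 
    have l2 := Heis.list_prod (List.ofFn fun t => (F (nz t))⁻¹ * F (nc t) * F (nz t))
      (by
        intro H hH i
        obtain ⟨t, rfl⟩ := (List.mem_ofFn' _ _).1 hH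
        simp [hvc]) 
    have d7 := congrArg (fun H : Heis (ℕ × Bool) => H.M i j) d5
    rw [Heis.mul_M, Heis.mul_M, hvl, (l1 i j).1, (l1 i j).2, (l2 i j).2] at d7
    simp only [List.map_ofFn, List.sum_ofFn, Function.comp_def, Heis.comm_M,
      Heis.conj_M _ _ (hvc _), Heis.one_M] at d7
    simp only [Heis.inv_M, hvl, hvc, mul_zero, add_zero, Finset.sum_neg_distrib]
    linarith
  refine ⟨I.reverse.map vi, ?_, ?_, ?_, ?_, ?_⟩
  · rw [prod_vi]
    rw [hDv.1] at c1
    have : (I.map ival).prod = Cl := by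
      have := eq_inv_of_mul_eq_one_right c1
      simpa using this
    rw [this]; simp
  · have : ∀ I : List (Item Γ), ((I.map vi).filterMap Sum.getLeft?).length =
        (I.filterMap Sum.getLeft?).length := by
      intro I
      induction I with
      | nil => rfl
      | cons i I ih => 
        rcases i with ⟨_, _⟩ | ⟨_, _⟩ <;>
          simp only [List.map_cons, vi, List.filterMap_cons, Sum.getLeft?_inl, Sum.getLeft?_inr,
            Sum.getRight?_inl, Sum.getRight?_inr, List.length_cons, ih]
    rw [this, List.filterMap_reverse, List.length_reverse, c2]
    exact hkg
  · have : ∀ I : List (Item Γ), ((I.map vi).filterMap Sum.getRight?).map Prod.fst =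
        ((I.filterMap Sum.getRight?).map Prod.fst).map (fun d => d⁻¹) := by
      intro I
      induction I with
      | nil => rfl
      | cons i I ih => 
        rcases i with ⟨_, _⟩ | ⟨_, _⟩ <;>
          simp only [List.map_cons, vi, List.filterMap_cons, Sum.getLeft?_inl, Sum.getLeft?_inr,
            Sum.getRight?_inl, Sum.getRight?_inr, List.length_cons, ih]
    rw [this, List.filterMap_reverse, List.map_reverse]
    rw [hDv.2] at c3
    refine ((List.reverse_perm _).map _).trans ((c3.map _).trans ?_)
    rw [List.map_ofFn]
    simp [Function.comp_def]
  · intro x y h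
    obtain ⟨i, hi', hv⟩ := List.mem_map.1 h
    rw [List.mem_reverse] at hi'
    rcases i with ⟨u, w⟩ | ⟨_, _⟩
    · simp only [vi, Sum.inl.injEq, Prod.mk.injEq] at hv
      obtain ⟨rfl, rfl⟩ := hv
      have := c4 _ _ hi'
      omega
    · simp [vi] at hv
  · intro d z h
    obtain ⟨i, hi', hv⟩ := List.mem_map.1 h
    rw [List.mem_reverse] at hi'
    rcases i with ⟨u, w⟩ | ⟨u, w⟩
    · simp [vi] at hv
    · simp only [vi, Sum.inr.injEq, Prod.mk.injEq] at hv
      obtain ⟨rfl, rfl⟩ := hv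
      have := c5 _ _ hi'
      omega

end Core

/-! ### The concrete group -/

section Concrete
open Monoid
variable (r k : ℕ) (ranks : Fin k → ℕ)

/-- abelian factors -/
def AF : Fin r ⊕ Fin k → Type
  | Sum.inl _ => Multiplicative ℤ
  | Sum.inr i => Multiplicative (Fin (ranks i) →₀ ℤ)

noncomputable instance instAF : (i : Fin r ⊕ Fin k) → CommGroup (AF r k ranks i)
  | Sum.inl _ => inferInstanceAs (CommGroup (Multiplicative ℤ))
  | Sum.inr i => inferInstanceAs (CommGroup (Multiplicative (Fin (ranks i) →₀ ℤ)))

/-- type of a generator -/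
def tG : B r k ranks → Fin r ⊕ Fin k
  | Sum.inl j => Sum.inl j
  | Sum.inr p => Sum.inr p.1

/-- generator inside its abelian factor -/
noncomputable def aG : (b : B r k ranks) → AF r k ranks (tG r k ranks b)
  | Sum.inl _ => (Multiplicative.ofAdd (1 : ℤ) : Multiplicative ℤ)
  | Sum.inr ⟨i, j⟩ => (Multiplicative.ofAdd (Finsupp.single j (1 : ℤ)) :
      Multiplicative (Fin (ranks i) →₀ ℤ))

/-- factorwise map to the free product of abelian groups -/
noncomputable def phf : (o : Option (Fin k)) → Fam r k ranks o →* CoprodI (AF r k ranks)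
  | none => (FreeGroup.lift (fun j : Fin r =>
      CoprodI.of (M := AF r k ranks) (i := Sum.inl j)
        (show AF r k ranks (Sum.inl j) from Multiplicative.ofAdd (1 : ℤ))) :
          FreeGroup (Fin r) →* CoprodI (AF r k ranks))
  | some i => (CoprodI.of (M := AF r k ranks) (i := Sum.inr i))

/-- inclusion of the abelian factors -/
noncomputable def iof : (i : Fin r ⊕ Fin k) → AF r k ranks i →* G r k ranks
  | Sum.inl j => (zpowersHom (G r k ranks) (gen r k ranks (Sum.inl j)) :
      Multiplicative ℤ →* G r k ranks)
  | Sum.inr i => (CoprodI.of (M := Fam r k ranks) (i := some i))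

lemma phf_gen (b : B r k ranks) : CoprodI.lift (phf r k ranks) (gen r k ranks b) =
    CoprodI.of (aG r k ranks b) := by
  rcases b with j | ⟨i, j⟩
  · refine (CoprodI.lift_of (phf r k ranks) (i := none) (FreeGroup.of j)).trans ?_
    exact FreeGroup.lift_apply_of (f := fun j : Fin r =>
      CoprodI.of (M := AF r k ranks) (i := Sum.inl j)
        (show AF r k ranks (Sum.inl j) from Multiplicative.ofAdd (1 : ℤ)))
  · exact CoprodI.lift_of (phf r k ranks) (i := some i)
      (Multiplicative.ofAdd (Finsupp.single j (1 : ℤ)) : Multiplicative (Fin (ranks i) →₀ ℤ))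

lemma iof_gen (b : B r k ranks) : iof r k ranks (tG r k ranks b) (aG r k ranks b) =
    gen r k ranks b := by
  rcases b with j | ⟨i, j⟩
  · show zpowersHom (G r k ranks) (gen r k ranks (Sum.inl j)) (Multiplicative.ofAdd (1 : ℤ)) = _
    simp
  · rfl

lemma mem_closure (x : G r k ranks) : x ∈ Subgroup.closure (Set.range (gen r k ranks)) := by
  induction x using CoprodI.induction_on with
  | one => exact one_mem _
  | mul x y hx hy => exact mul_mem hx hy
  | of o m =>
    rcases o with _ | i
    · let f : FreeGroup (Fin r) →* G r k ranks := CoprodI.of (M := Fam r k ranks) (i := none)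
      show f m ∈ _
      have hm : ∀ m : FreeGroup (Fin r), f m ∈ Subgroup.closure (Set.range (gen r k ranks)) := by
        intro m
        induction m using FreeGroup.induction_on with
        | C1 => rw [map_one]; exact one_mem _
        | of j => exact Subgroup.subset_closure ⟨Sum.inl j, rfl⟩
        | inv_of j h => rw [map_inv]; exact inv_mem h
        | mul a b ha hb => rw [map_mul]; exact mul_mem ha hb
      exact hm m
    · let f : Multiplicative (Fin (ranks i) →₀ ℤ) →* G r k ranks :=
        CoprodI.of (M := Fam r k ranks) (i := some i)
      have hm : ∀ m : Fin (ranks i) →₀ ℤ, f (Multiplicative.ofAdd m) ∈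
          Subgroup.closure (Set.range (gen r k ranks)) := by
        intro m
        induction m using Finsupp.induction_linear with
        | zero => rw [ofAdd_zero, map_one]; exact one_mem _
        | add a b ha hb => rw [ofAdd_add, map_mul]; exact mul_mem ha hb
        | single j n =>
          have : Finsupp.single j n = n • Finsupp.single j (1 : ℤ) := by simp
          rw [this, ofAdd_zsmul, map_zpow]
          have hj : f (Multiplicative.ofAdd (Finsupp.single j (1 : ℤ))) ∈
              Subgroup.closure (Set.range (gen r k ranks)) :=
            Subgroup.subset_closure ⟨Sum.inr ⟨i, j⟩, rfl⟩
          exact zpow_mem hj n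
      exact hm m

lemma exists_word (x : G r k ranks) : ∃ w : Wd (B r k ranks), ev (gen r k ranks) w = x := by
  induction mem_closure r k ranks x using Subgroup.closure_induction with
  | mem x hx => obtain ⟨b, rfl⟩ := hx; exact ⟨[(b, true)], by simp [lv]⟩
  | one => exact ⟨[], rfl⟩
  | mul x y _ _ hx hy =>
    obtain ⟨u, rfl⟩ := hx
    obtain ⟨v, rfl⟩ := hy
    exact ⟨u ++ v, by simp⟩
  | inv x _ hx =>
    obtain ⟨u, rfl⟩ := hx
    exact ⟨iw u, by simp⟩

lemma wl_le (w : Wd (B r k ranks)) : wl r k ranks (ev (gen r k ranks) w) ≤ w.length := by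
  apply Nat.sInf_le
  refine ⟨w.map (lv (gen r k ranks)), by simp, ?_, rfl⟩
  intro y hy
  obtain ⟨⟨b, s⟩, _, rfl⟩ := List.mem_map.1 hy
  cases s
  · exact ⟨b, Or.inr (by simp [lv])⟩
  · exact ⟨b, Or.inl (by simp [lv])⟩

lemma wl_word (x : G r k ranks) :
    ∃ w : Wd (B r k ranks), ev (gen r k ranks) w = x ∧ w.length = wl r k ranks x := by
  have hne : {n | ∃ l : List (G r k ranks), l.length = n ∧
    (∀ y ∈ l, ∃ b, y = gen r k ranks b ∨ y = (gen r k ranks b)⁻¹) ∧ l.prod = x}.Nonempty := by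
    obtain ⟨w, hw⟩ := exists_word r k ranks x
    refine ⟨w.length, w.map (lv (gen r k ranks)), by simp, ?_, hw⟩
    intro y hy
    obtain ⟨⟨b, s⟩, _, rfl⟩ := List.mem_map.1 hy
    cases s
    · exact ⟨b, Or.inr (by simp [lv])⟩
    · exact ⟨b, Or.inl (by simp [lv])⟩
  obtain ⟨l, h1, h2, h3⟩ := Nat.sInf_mem hne
  have key : ∀ l : List (G r k ranks),
      (∀ y ∈ l, ∃ b, y = gen r k ranks b ∨ y = (gen r k ranks b)⁻¹) →
      ∃ w : Wd (B r k ranks), ev (gen r k ranks) w = l.prod ∧ w.length = l.length := by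
    intro l
    induction l with
    | nil => intro _; exact ⟨[], rfl, rfl⟩
    | cons y l ih =>
      intro h
      obtain ⟨w, e1, e2⟩ := ih (fun z hz => h z (by simp [hz]))
      obtain ⟨b, rfl | rfl⟩ := h y (by simp)
      · exact ⟨(b, true) :: w, by simp [e1, lv], by simp [e2]⟩
      · exact ⟨(b, false) :: w, by simp [e1, lv], by simp [e2]⟩
  obtain ⟨w, e1, e2⟩ := key l h2
  exact ⟨w, e1.trans h3, e2.trans h1⟩

lemma wl_one : wl r k ranks 1 = 0 := by
  have := wl_le r k ranks []
  simpa using this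

lemma wl_mul (a b : G r k ranks) : wl r k ranks (a * b) ≤ wl r k ranks a + wl r k ranks b := by
  obtain ⟨u, rfl, hu⟩ := wl_word r k ranks a
  obtain ⟨v, rfl, hv⟩ := wl_word r k ranks b
  rw [← hu, ← hv, ← ev_append, ← List.length_append]
  exact wl_le r k ranks _

lemma wl_inv_le (a : G r k ranks) : wl r k ranks a⁻¹ ≤ wl r k ranks a := by
  obtain ⟨u, rfl, hu⟩ := wl_word r k ranks a
  rw [← hu, ← ev_iw, ← iw_length]
  exact wl_le r k ranks _

lemma wl_inv (a : G r k ranks) : wl r k ranks a⁻¹ = wl r k ranks a := by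
  apply le_antisymm (wl_inv_le r k ranks a)
  have := wl_inv_le r k ranks a⁻¹
  rwa [inv_inv] at this

lemma wl_gen (b : B r k ranks) : wl r k ranks (gen r k ranks b) ≤ 1 := by
  have := wl_le r k ranks [(b, true)]
  simpa [lv] using this

end Concrete

/-- Minimal solutions of the standard orientable quadratic equation
(∏ᵢ [xᵢ,yᵢ])·(∏ⱼ zⱼ⁻¹Cⱼzⱼ)·C = 1 of genus g with m−1 conjugated coefficients
(here m' = m − 1 ≥ 0, so m ≥ 1) over the free product G are bounded by N·s² where
s = 2g + (m−1) + Σ|Cⱼ| + |C| and N depends only on G.  Here [x,y] = x⁻¹y⁻¹xy. -/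
theorem standard_orientable_minimal_solution_bound (r k : ℕ) (ranks : Fin k → ℕ) :
    ∃ N : ℕ, ∀ (g m' : ℕ) (C : Fin m' → G r k ranks) (Clast : G r k ranks),
      (∃ (x y : Fin g → G r k ranks) (z : Fin m' → G r k ranks),
        (List.ofFn fun i => (x i)⁻¹ * (y i)⁻¹ * x i * y i).prod *
          (List.ofFn fun j => (z j)⁻¹ * C j * z j).prod * Clast = 1) →
      ∃ (x y : Fin g → G r k ranks) (z : Fin m' → G r k ranks),
        (List.ofFn fun i => (x i)⁻¹ * (y i)⁻¹ * x i * y i).prod *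
          (List.ofFn fun j => (z j)⁻¹ * C j * z j).prod * Clast = 1 ∧
        (∀ i : Fin g, wl r k ranks (x i) ≤
          N * (2 * g + m' + (∑ j, wl r k ranks (C j)) + wl r k ranks Clast) ^ 2) ∧
        (∀ i : Fin g, wl r k ranks (y i) ≤
          N * (2 * g + m' + (∑ j, wl r k ranks (C j)) + wl r k ranks Clast) ^ 2) ∧
        (∀ j : Fin m', wl r k ranks (z j) ≤
          N * (2 * g + m' + (∑ j, wl r k ranks (C j)) + wl r k ranks Clast) ^ 2) := by
  refine ⟨100, ?_⟩
  rintro g m' C Clast ⟨x, y, z, heq⟩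
  obtain ⟨I, i1, i2, i3, i4, i5⟩ := core (gen r k ranks) (tG r k ranks) (aG r k ranks)
    (Monoid.CoprodI.lift (phf r k ranks)) (iof r k ranks) (phf_gen r k ranks) (iof_gen r k ranks)
    (fun _ a b => mul_comm a b) (wl r k ranks) (wl_one r k ranks) (wl_mul r k ranks)
    (wl_inv r k ranks) (wl_gen r k ranks) (wl_word r k ranks) g m' C Clast x y z heq _ rfl
  obtain ⟨x', y', z', e, bx, bY, bz⟩ := finish (wl r k ranks) (wl_one r k ranks) (wl_mul r k ranks)
    (wl_inv r k ranks) g m' _ C Clast I i1 i2 i3 i4 i5 _ rfl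
  have key : 4 * (∑ j, wl r k ranks (C j) + wl r k ranks Clast) +
      2 * (g * (4 * (4 * (∑ j, wl r k ranks (C j) + wl r k ranks Clast))) +
        (m' * (2 * (4 * (∑ j, wl r k ranks (C j) + wl r k ranks Clast))) +
          ∑ j, wl r k ranks (C j))) ≤
      100 * (2 * g + m' + (∑ j, wl r k ranks (C j)) + wl r k ranks Clast) ^ 2 := by
    generalize ∑ j, wl r k ranks (C j) = p
    generalize wl r k ranks Clast = q
    have h1 : p ≤ p * p := Nat.le_mul_self p
    have h2 : q ≤ q * q := Nat.le_mul_self q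
    have : 4 * (p + q) + 2 * (g * (4 * (4 * (p + q))) + (m' * (2 * (4 * (p + q))) + p)) ≤
      4 * (p * p + q * q) + 2 * (g * (4 * (4 * (p + q))) + (m' * (2 * (4 * (p + q))) + p * p)) := by
      omega
    refine this.trans ?_
    zify
    have hp : (0 : ℤ) ≤ p := by positivity
    have hq : (0 : ℤ) ≤ q := by positivity
    have hg : (0 : ℤ) ≤ g := by positivity
    have hm : (0 : ℤ) ≤ m' := by positivity
    nlinarith [mul_nonneg hp hq, mul_nonneg hp hg, mul_nonneg hp hm, mul_nonneg hq hg,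
      mul_nonneg hq hm, mul_nonneg hg hm, mul_nonneg hp hp, mul_nonneg hq hq, mul_nonneg hg hg,
      mul_nonneg hm hm]
  exact ⟨x', y', z', e, fun i => (bx i).trans key, fun i => (bY i).trans key,
    fun j => (bz j).trans key⟩

end Stmt2
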